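/- arXiv:2511.01262 — 5 statements merged into one kernel-verified Lean document; each statement's English description precedes it below -/
import Mathlib

section
/- Let m ≥ 2, n = ⌊m/2⌋, l ∈ ℤ≥0, and λ, λ' ∈ Λ_{n,l}. If there exists an invertible matrix A ∈ GL_m(R_l) with A δ_{λ,l} Aᵀ = δ_{λ',l}, then λ = λ'. Equivalently, the congruence orbits of the matrices δ_{λ,l} under GL_m(R_l), for λ ∈ Λ_{n,l}, are pairwise distinct. -/
open Matrix

noncomputable section

/-- The jet ring `R_l = ℂ[t]/(t^{l+1})`. -/
abbrev Rl (l : ℕ) : Type :=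
  Polynomial ℂ ⧸ Ideal.span ({Polynomial.X ^ (l + 1)} : Set (Polynomial ℂ))

/-- The image of `t` in `R_l = ℂ[t]/(t^{l+1})`. -/
def tq (l : ℕ) : Rl l := Ideal.Quotient.mk _ Polynomial.X

/-- The entries of the 2×2 matrix `J = [[0,1],[-1,0]]`, as a function of
(row mod 2, column mod 2). -/
def Jc (a b : ℕ) : ℂ :=
  if a = 0 ∧ b = 1 then 1 else if a = 1 ∧ b = 0 then -1 else 0

/-- The skew-symmetric matrix `δ_{λ,l}` over `R_l`: block diagonal with 2×2 blocks
`t^{λ_1}J, …, t^{λ_n}J` (with `n = ⌊m/2⌋`, an entry `λ_i = l+1` giving a zero block),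
followed by a 1×1 zero block when `m` is odd. -/
def deltaJet (m l : ℕ) (lam : Fin (m / 2) → ℕ) :
    Matrix (Fin m) (Fin m) (Rl l) :=
  Matrix.of fun i j =>
    if h : (i : ℕ) / 2 = (j : ℕ) / 2 ∧ (i : ℕ) / 2 < m / 2 then
      tq l ^ lam ⟨(i : ℕ) / 2, h.2⟩ * algebraMap ℂ (Rl l) (Jc ((i : ℕ) % 2) ((j : ℕ) % 2))
    else 0

open Polynomial in
/-- The residue map `R_l → ℂ`, sending `t` to `0`. -/
def residueRl (l : ℕ) : Rl l →ₐ[ℂ] ℂ :=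
  Ideal.Quotient.liftₐ _ (aeval (0 : ℂ)) fun p hp => by
    obtain ⟨q, rfl⟩ := Ideal.mem_span_singleton.1 hp
    simp

/-- If `t^a x` is divisible by `t^(c+1)` in `R_l` with `a ≤ c ≤ l`, then `x` is divisible by `t`. -/
theorem residueRl_eq_zero_of_tq_pow_dvd {l a c : ℕ} (hac : a ≤ c) (hcl : c ≤ l) {x : Rl l}
    (hx : tq l ^ (c + 1) ∣ tq l ^ a * x) : residueRl l x = 0 := by
  obtain ⟨y, hy⟩ := hx
  obtain ⟨p, rfl⟩ := Ideal.Quotient.mk_surjective x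
  obtain ⟨q, rfl⟩ := Ideal.Quotient.mk_surjective y
  rw [tq, ← map_pow, ← map_pow, ← map_mul, ← map_mul, Ideal.Quotient.eq,
    Ideal.mem_span_singleton] at hy
  have h1 : (Polynomial.X : Polynomial ℂ) ^ (a + 1) ∣ Polynomial.X ^ a * p := by
    have h2 := (pow_dvd_pow (Polynomial.X : Polynomial ℂ) (by lia : a + 1 ≤ l + 1)).trans hy
    have h3 : (Polynomial.X : Polynomial ℂ) ^ (a + 1) ∣ Polynomial.X ^ (c + 1) * q :=
      (pow_dvd_pow _ (by lia)).mul_right q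
    exact (dvd_sub_left h3).1 h2
  rw [pow_succ, mul_dvd_mul_iff_left (pow_ne_zero _ Polynomial.X_ne_zero)] at h1
  obtain ⟨r, rfl⟩ := h1
  change Polynomial.aeval (0 : ℂ) (Polynomial.X * r) = 0
  simp

/-- An invertible matrix whose first `s` rows are supported on the first `r` columns has `s ≤ r`. -/
theorem Matrix.le_of_isUnit_of_forall_eq_zero {K : Type*} [Field K] {m r s : ℕ}
    {B : Matrix (Fin m) (Fin m) K} (hB : IsUnit B) (hs : s ≤ m) (hr : r ≤ m)
    (h : ∀ q p : Fin m, (q : ℕ) < s → r ≤ (p : ℕ) → B q p = 0) : s ≤ r := by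
  have hli := (Matrix.linearIndependent_rows_of_isUnit hB).comp _ (Fin.castLE_injective hs)
  have hli' : LinearIndependent K fun q : Fin s => fun p : Fin r =>
      B (Fin.castLE hs q) (Fin.castLE hr p) := by
    rw [Fintype.linearIndependent_iff] at hli ⊢
    intro g hg
    refine hli g (funext fun p => ?_)
    by_cases hp : (p : ℕ) < r
    · simpa [Finset.sum_apply] using congrFun hg ⟨p, hp⟩
    · simp only [Finset.sum_apply, Pi.smul_apply, Function.comp_apply, Pi.zero_apply]
      refine Finset.sum_eq_zero fun q _ => ?_
      simp [Matrix.row, h (Fin.castLE hs q) p (by simp) (not_lt.1 hp)]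
  simpa using hli'.fintype_card_le_finrank

/-- Left multiplication by `δ_{λ,l}` scales each row in a block by `± t^λ`, up to a permutation
of the rows. -/
theorem exists_deltaJet_mul_apply (m l : ℕ) (lam : Fin (m / 2) → ℕ) (j : Fin m)
    (hj : (j : ℕ) / 2 < m / 2) :
    ∃ (q : Fin m) (u : ℂ), u ≠ 0 ∧ ∀ (N : Matrix (Fin m) (Fin m) (Rl l)) (p : Fin m),
      (deltaJet m l lam * N) q p =
        tq l ^ lam ⟨(j : ℕ) / 2, hj⟩ * (algebraMap ℂ (Rl l) u * N j p) := by
  obtain ⟨q, hq, hqj⟩ : ∃ q : Fin m, (q : ℕ) / 2 = (j : ℕ) / 2 ∧ (q : ℕ) % 2 = 1 - (j : ℕ) % 2 :=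
    ⟨⟨2 * ((j : ℕ) / 2) + (1 - (j : ℕ) % 2), by lia⟩, by simp only; omega, by simp only; omega⟩
  refine ⟨q, Jc ((q : ℕ) % 2) ((j : ℕ) % 2), ?_, fun N p => ?_⟩
  · rw [hqj]
    obtain h | h := Nat.mod_two_eq_zero_or_one (j : ℕ) <;> simp [h, Jc]
  · rw [Matrix.mul_apply, Finset.sum_eq_single j]
    · simp [deltaJet, hq, hj, mul_assoc]
    · intro k _ hk
      by_cases hkq : (q : ℕ) / 2 = (k : ℕ) / 2
      · have hkj : (k : ℕ) % 2 = (q : ℕ) % 2 := by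
          have : (k : ℕ) ≠ j := fun e => hk (Fin.ext e)
          lia
        have hJ : Jc ((q : ℕ) % 2) ((k : ℕ) % 2) = 0 := by
          rw [hkj, Jc]
          split_ifs <;> first | rfl | lia
        simp [deltaJet, hJ]
      · simp [deltaJet, hkq]
    · simp

/-- Columns of `δ_{λ,l}` from block `i` on are divisible by `t^{λ_i}`. -/
theorem tq_pow_dvd_deltaJet_apply {m l : ℕ} {lam : Fin (m / 2) → ℕ} (hlam : Monotone lam)
    (i : Fin (m / 2)) (k p : Fin m) (hp : 2 * (i : ℕ) ≤ p) :
    tq l ^ lam i ∣ deltaJet m l lam k p := by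
  rw [deltaJet, Matrix.of_apply]
  split_ifs with h
  · exact (pow_dvd_pow _ (hlam (Fin.le_def.2 (by simp only; lia)))).mul_right _
  · exact dvd_zero _

theorem le_of_deltaJet_congruent {m l : ℕ} {lam lam' : Fin (m / 2) → ℕ}
    (hlam : Monotone lam) (hlam' : Monotone lam') (hle' : ∀ i, lam' i ≤ l + 1)
    {A : Matrix (Fin m) (Fin m) (Rl l)} (hA : IsUnit A)
    (h : A * deltaJet m l lam * Aᵀ = deltaJet m l lam') : lam' ≤ lam := by
  intro i
  by_contra! hi
  obtain ⟨C, hC⟩ := hA.exists_left_inv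
  have hmul : deltaJet m l lam * Aᵀ = C * deltaJet m l lam' := by
    rw [← h, mul_assoc, ← mul_assoc C, hC, one_mul]
  have hunit : IsUnit (Aᵀ.map (residueRl l)) :=
    ((Matrix.isUnit_transpose A).2 hA).map (residueRl l).toRingHom.mapMatrix
  have key := Matrix.le_of_isUnit_of_forall_eq_zero (r := 2 * (i : ℕ)) (s := 2 * (i : ℕ) + 2)
    hunit (by lia) (by lia) fun j p hj hp => by
      have hjm : (j : ℕ) / 2 < m / 2 := by lia
      obtain ⟨q, u, hu, hq⟩ := exists_deltaJet_mul_apply m l lam j hjm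
      have hdvd : tq l ^ (lam i + 1) ∣ (C * deltaJet m l lam') q p := by
        rw [Matrix.mul_apply]
        exact Finset.dvd_sum fun k _ => Dvd.dvd.mul_left
          ((pow_dvd_pow _ hi).trans (tq_pow_dvd_deltaJet_apply hlam' i k p hp)) _
      rw [← hmul, hq] at hdvd
      have hji : lam ⟨(j : ℕ) / 2, hjm⟩ ≤ lam i := hlam (Fin.le_def.2 (by simp only; lia))
      have hres := residueRl_eq_zero_of_tq_pow_dvd hji (by have := hle' i; lia) hdvd
      rw [map_mul, AlgHom.commutes] at hres
      exact (mul_eq_zero.1 hres).resolve_left hu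
  lia

/-- If `λ, λ' ∈ Λ_{n,l}` and some `A ∈ GL_m(R_l)` satisfies `A δ_{λ,l} Aᵀ = δ_{λ',l}`,
then `λ = λ'`; i.e. the congruence orbits of the `δ_{λ,l}` under `GL_m(R_l)` are
pairwise distinct. -/
theorem deltaJet_congruent_iff_eq (m l : ℕ) (hm : 2 ≤ m)
    (lam lam' : Fin (m / 2) → ℕ)
    (hlam : Monotone lam) (hlam' : Monotone lam')
    (hle : ∀ i, lam i ≤ l + 1) (hle' : ∀ i, lam' i ≤ l + 1)
    (A : Matrix (Fin m) (Fin m) (Rl l)) (hA : IsUnit A)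
    (h : A * deltaJet m l lam * Aᵀ = deltaJet m l lam') :
    lam = lam' := by
  refine le_antisymm ?_ (le_of_deltaJet_congruent hlam hlam' hle' hA h)
  obtain ⟨C, hC⟩ := hA.exists_left_inv
  refine le_of_deltaJet_congruent hlam' hlam hle (IsUnit.of_mul_eq_one A hC) ?_
  have hCt : Aᵀ * Cᵀ = 1 := by rw [← Matrix.transpose_mul, hC, Matrix.transpose_one]
  rw [← h, mul_assoc A, ← mul_assoc C, hC, one_mul, mul_assoc, hCt, mul_one]

end
end

section
/- Let l ∈ ℤ≥0, R = ℂ[t]/(t^{l+1}), w ≥ 1, let U_1,…,U_w be invertible square matrices over R of sizes r_1,…,r_w, and let 0 ≤ λ̄_1 < λ̄_2 < … < λ̄_w ≤ l be integers. Let D be the block diagonal matrix with blocks t^{λ̄_1}U_1, …, t^{λ̄_w}U_w, and let A be a square matrix over R of size r_1+…+r_w, written in blocks A = (A_{ij})_{1≤i,j≤w} with A_{ij} of size r_i × r_j, such that A D Aᵀ = D. Then A and all diagonal blocks A_{11},…,A_{ww} are invertible over R (equivalently, the constant terms in t of det A, det A_{11}, …, det A_{ww} are all nonzero), and moreover A_{ii}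 U_i A_{ii}ᵀ ≡ U_i modulo the ideal generated by t, for every i. -/
open Matrix

noncomputable section

/-- The `(i,j)` block of a block matrix indexed by `Σ i, Fin (r i)`. -/
def blockOf {w : ℕ} {r : Fin w → ℕ} {R : Type*}
    (A : Matrix ((i : Fin w) × Fin (r i)) ((i : Fin w) × Fin (r i)) R)
    (i j : Fin w) : Matrix (Fin (r i)) (Fin (r j)) R :=
  Matrix.of fun a b => A ⟨i, a⟩ ⟨j, b⟩

theorem tq_pow_succ (l : ℕ) : tq l ^ (l + 1) = 0 := by
  rw [tq, ← map_pow, Ideal.Quotient.eq_zero_iff_mem]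
  exact Ideal.subset_span rfl

/-- Cancellation of powers of `t` up to order `l`. -/
theorem tq_dvd_of_pow_succ_dvd {l a : ℕ} (ha : a ≤ l) {x : Rl l}
    (h : tq l ^ (a + 1) ∣ tq l ^ a * x) : tq l ∣ x := by
  obtain ⟨y, hy⟩ := h
  obtain ⟨p, rfl⟩ := Ideal.Quotient.mk_surjective x
  obtain ⟨q, rfl⟩ := Ideal.Quotient.mk_surjective y
  simp only [tq, ← map_pow, ← map_mul] at hy ⊢
  rw [Ideal.Quotient.eq, Ideal.mem_span_singleton] at hy
  have h1 : (Polynomial.X : Polynomial ℂ) ^ (a + 1) ∣ Polynomial.X ^ a * p :=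
    (dvd_sub_left (Dvd.intro q rfl)).1 ((pow_dvd_pow _ (by omega)).trans hy)
  rw [pow_succ] at h1
  exact map_dvd _ ((mul_dvd_mul_iff_left (pow_ne_zero a Polynomial.X_ne_zero)).1 h1)

/-- Evaluation at `t = 0`. -/
def constTerm (l : ℕ) : Rl l →+* ℂ :=
  Ideal.Quotient.lift _ (Polynomial.evalRingHom 0) fun p hp => by
    obtain ⟨q, rfl⟩ := Ideal.mem_span_singleton.1 hp
    simp

theorem constTerm_mk (l : ℕ) (p : Polynomial ℂ) :
    constTerm l (Ideal.Quotient.mk _ p) = p.eval 0 := rfl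

theorem constTerm_surjective (l : ℕ) : Function.Surjective (constTerm l) := fun c =>
  ⟨Ideal.Quotient.mk _ (Polynomial.C c), by simp [constTerm_mk]⟩

theorem constTerm_eq_zero_iff {l : ℕ} {x : Rl l} : constTerm l x = 0 ↔ tq l ∣ x := by
  constructor
  · obtain ⟨p, rfl⟩ := Ideal.Quotient.mk_surjective x
    intro h
    refine map_dvd _ (Polynomial.X_dvd_iff.2 ?_)
    rwa [constTerm_mk, ← Polynomial.coeff_zero_eq_eval_zero] at h
  · rintro ⟨y, rfl⟩
    simp [tq, constTerm_mk]

theorem isUnit_of_isUnit_constTerm {l : ℕ} {x : Rl l} (h : IsUnit (constTerm l x)) :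
    IsUnit x := by
  set c : Rl l := algebraMap ℂ (Rl l) (constTerm l x) with hc
  have hcu : IsUnit c := h.map _
  have h0 : constTerm l (x - c) = 0 := by
    have : constTerm l c = constTerm l x := by
      change constTerm l (Ideal.Quotient.mk _ (Polynomial.C _)) = _
      simp [constTerm_mk]
    rw [map_sub, this, sub_self]
  obtain ⟨y, hy⟩ := constTerm_eq_zero_iff.1 h0
  have hn : IsNilpotent (x - c) := ⟨l + 1, by rw [hy, mul_pow, tq_pow_succ, zero_mul]⟩
  simpa using hn.isUnit_add_left_of_commute hcu (Commute.all _ _)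

theorem Matrix.isUnit_of_isUnit_map_constTerm {l : ℕ} {n : Type*} [Fintype n] [DecidableEq n]
    {M : Matrix n n (Rl l)} (h : IsUnit (M.map (constTerm l))) : IsUnit M := by
  rw [Matrix.isUnit_iff_isUnit_det] at h ⊢
  refine isUnit_of_isUnit_constTerm ?_
  rwa [RingHom.map_det]

/-- A linear endomorphism `f` with `N ⊆ f N`, where `N` is finite, is injective on the part
of `N` that it maps into `N`. -/
theorem LinearMap.eq_zero_of_le_map {R M : Type*} [CommRing R] [AddCommGroup M] [Module R M]
    (N : Submodule R M) [Module.Finite R N] (f : M →ₗ[R] M) (hN : N ≤ N.map f)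
    {x : M} (hx : x ∈ N) (hfx : f x = 0) : x = 0 := by
  let K : Submodule R M := N ⊓ N.comap f
  let i : K →ₗ[R] N := Submodule.inclusion inf_le_left
  let g : K →ₗ[R] N := (f.domRestrict K).codRestrict N fun y => y.2.2
  have hg : Function.Surjective g := by
    rintro ⟨y, hy⟩
    obtain ⟨z, hz, rfl⟩ := hN hy
    exact ⟨⟨z, hz, hy⟩, rfl⟩
  have hinj := OrzechProperty.injective_of_surjective_of_injective i g
    (Submodule.inclusion_injective _) hg
  have hxK : x ∈ K := ⟨hx, by simp [hfx]⟩
  have : (⟨x, hxK⟩ : K) = 0 := hinj (Subtype.ext (hfx.trans (map_zero f).symm))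
  simpa using congrArg Subtype.val this

/-- If `A D B = D` and `D` divides `t ^ l`, then `A` is invertible. -/
theorem Matrix.isUnit_of_mul_mul_eq {l : ℕ} {n : Type*} [Fintype n] [DecidableEq n]
    {A B D E : Matrix n n (Rl l)} (hA : A * D * B = D) (hE : D * E = tq l ^ l • 1) :
    IsUnit A := by
  refine Matrix.isUnit_of_isUnit_map_constTerm ?_
  rw [← Matrix.mulVec_injective_iff_isUnit]
  refine (injective_iff_map_eq_zero (A.map (constTerm l)).mulVecLin).2 fun v hv => ?_
  choose x hx using fun i => constTerm_surjective l (v i)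
  have hAx : ∀ i, tq l ∣ (A *ᵥ x) i := fun i => by
    rw [← constTerm_eq_zero_iff, RingHom.map_mulVec]
    have : constTerm l ∘ x = v := funext hx
    rw [this]
    exact congrFun hv i
  have hAx0 : A *ᵥ (tq l ^ l • x) = 0 := by
    ext i
    obtain ⟨y, hy⟩ := hAx i
    rw [Matrix.mulVec_smul, Pi.smul_apply, hy, smul_eq_mul, ← mul_assoc, ← pow_succ,
      tq_pow_succ, zero_mul, Pi.zero_apply]
  have hx0 : tq l ^ l • x = 0 := by
    refine LinearMap.eq_zero_of_le_map (LinearMap.range D.mulVecLin) A.mulVecLin ?_ ?_ hAx0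
    · rintro _ ⟨y, rfl⟩
      refine ⟨D *ᵥ (B *ᵥ y), ⟨_, rfl⟩, ?_⟩
      simp [Matrix.mulVec_mulVec, ← Matrix.mul_assoc, hA]
    · exact ⟨E *ᵥ x, by simp [Matrix.mulVec_mulVec, hE, Matrix.smul_mulVec]⟩
  ext i
  rw [← hx i, Pi.zero_apply, constTerm_eq_zero_iff]
  refine tq_dvd_of_pow_succ_dvd le_rfl ?_
  have := congrFun hx0 i
  rw [Pi.smul_apply, smul_eq_mul] at this
  rw [this]
  exact dvd_zero _

theorem Matrix.dvd_mul_apply {R m n p : Type*} [CommSemiring R] [Fintype n] {s t : R}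
    {M : Matrix m n R} {N : Matrix n p R} (hM : ∀ a b, s ∣ M a b) (hN : ∀ a b, t ∣ N a b)
    (a : m) (b : p) : s * t ∣ (M * N) a b :=
  Finset.dvd_sum fun _ _ => mul_dvd_mul (hM _ _) (hN _ _)

section blockOf

variable {w : ℕ} {r : Fin w → ℕ} {R : Type*}

theorem blockOf_transpose (M : Matrix ((i : Fin w) × Fin (r i)) ((i : Fin w) × Fin (r i)) R)
    (i j : Fin w) : blockOf Mᵀ i j = (blockOf M j i)ᵀ := rfl

variable [CommRing R]

theorem blockOf_mul (M N : Matrix ((i : Fin w) × Fin (r i)) ((i : Fin w) × Fin (r i)) R)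
    (i j : Fin w) : blockOf (M * N) i j = ∑ k, blockOf M i k * blockOf N k j := by
  ext a b
  simp [blockOf, Matrix.mul_apply, Fintype.sum_sigma, Matrix.sum_apply]

theorem blockOf_blockDiagonal'_self (d : ∀ i, Matrix (Fin (r i)) (Fin (r i)) R) (i : Fin w) :
    blockOf (Matrix.blockDiagonal' d) i i = d i := by
  ext a b
  simp [blockOf, Matrix.blockDiagonal'_apply_eq]

theorem blockOf_blockDiagonal'_ne (d : ∀ i, Matrix (Fin (r i)) (Fin (r i)) R) {i j : Fin w}
    (h : i ≠ j) : blockOf (Matrix.blockDiagonal' d) i j = 0 := by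
  ext a b
  simp [blockOf, Matrix.blockDiagonal'_apply_ne _ _ _ h]

theorem blockOf_blockDiagonal'_mul (d : ∀ i, Matrix (Fin (r i)) (Fin (r i)) R)
    (M : Matrix ((i : Fin w) × Fin (r i)) ((i : Fin w) × Fin (r i)) R) (i j : Fin w) :
    blockOf (Matrix.blockDiagonal' d * M) i j = d i * blockOf M i j := by
  rw [blockOf_mul, Fintype.sum_eq_single i, blockOf_blockDiagonal'_self]
  intro k hk
  rw [blockOf_blockDiagonal'_ne d hk.symm, Matrix.zero_mul]

theorem blockOf_mul_blockDiagonal' (d : ∀ i, Matrix (Fin (r i)) (Fin (r i)) R)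
    (M : Matrix ((i : Fin w) × Fin (r i)) ((i : Fin w) × Fin (r i)) R) (i j : Fin w) :
    blockOf (M * Matrix.blockDiagonal' d) i j = blockOf M i j * d j := by
  rw [blockOf_mul, Fintype.sum_eq_single j, blockOf_blockDiagonal'_self]
  intro k hk
  rw [blockOf_blockDiagonal'_ne d hk, Matrix.mul_zero]

/-- If `D` has diagonal blocks `t ^ λ_i U_i` with `λ_i ≤ l`, then `D` divides `t ^ l`. -/
theorem blockDiagonal'_pow_smul_mul (t : R) (U : ∀ i, Matrix (Fin (r i)) (Fin (r i)) R)
    (hU : ∀ i, IsUnit (U i)) {l : ℕ} {lamb : Fin w → ℕ} (hle : ∀ i, lamb i ≤ l) :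
    Matrix.blockDiagonal' (fun i => t ^ lamb i • U i) *
      Matrix.blockDiagonal' (fun i => t ^ (l - lamb i) • (U i)⁻¹) = t ^ l • 1 := by
  rw [← Matrix.blockDiagonal'_mul]
  have h : (fun i => (t ^ lamb i • U i) * (t ^ (l - lamb i) • (U i)⁻¹)) =
      t ^ l • (1 : ∀ i : Fin w, Matrix (Fin (r i)) (Fin (r i)) R) := by
    funext i
    rw [Matrix.smul_mul, Matrix.mul_smul, smul_smul, ← pow_add,
      Nat.add_sub_cancel' (hle i),
      Matrix.mul_nonsing_inv _ ((Matrix.isUnit_iff_isUnit_det _).1 (hU i))]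
    rfl
  rw [h, Matrix.blockDiagonal'_smul, Matrix.blockDiagonal'_one]

/-- If `A D Aᵀ = D` with `A` invertible, then the columns of `D Aᵀ = A⁻¹ D` are divisible by
the same powers of `t` as those of `D`. -/
theorem pow_dvd_smul_mul_transpose_blockOf (t : R)
    (U : ∀ i, Matrix (Fin (r i)) (Fin (r i)) R) (lamb : Fin w → ℕ)
    {A : Matrix ((i : Fin w) × Fin (r i)) ((i : Fin w) × Fin (r i)) R} (hAu : IsUnit A)
    (hA : A * Matrix.blockDiagonal' (fun i => t ^ lamb i • U i) * Aᵀ =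
      Matrix.blockDiagonal' (fun i => t ^ lamb i • U i)) (i k : Fin w) (a : Fin (r k))
    (b : Fin (r i)) :
    t ^ lamb i ∣ ((t ^ lamb k • U k) * (blockOf A i k)ᵀ) a b := by
  rw [← blockOf_transpose, ← blockOf_blockDiagonal'_mul (fun i => t ^ lamb i • U i)]
  have h : Matrix.blockDiagonal' (fun i => t ^ lamb i • U i) * Aᵀ =
      A⁻¹ * Matrix.blockDiagonal' (fun i => t ^ lamb i • U i) := by
    conv_rhs => rw [← hA, Matrix.mul_assoc,
      Matrix.nonsing_inv_mul_cancel_left _ _ ((Matrix.isUnit_iff_isUnit_det _).1 hAu)]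
  rw [h, blockOf_mul_blockDiagonal', Matrix.mul_smul, Matrix.smul_apply]
  exact Dvd.intro _ rfl

/-- If `A D Aᵀ = D` with `A` invertible, then `A_{ii} U_i A_{ii}ᵀ ≡ U_i` modulo `t`. -/
theorem dvd_blockOf_mul_mul_transpose_sub (t : R) {l : ℕ}
    (hcancel : ∀ {a : ℕ}, a ≤ l → ∀ {x : R}, t ^ (a + 1) ∣ t ^ a * x → t ∣ x)
    (U : ∀ i, Matrix (Fin (r i)) (Fin (r i)) R) (hU : ∀ i, IsUnit (U i))
    {lamb : Fin w → ℕ} (hmono : StrictMono lamb) (hle : ∀ i, lamb i ≤ l)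
    {A : Matrix ((i : Fin w) × Fin (r i)) ((i : Fin w) × Fin (r i)) R} (hAu : IsUnit A)
    (hA : A * Matrix.blockDiagonal' (fun i => t ^ lamb i • U i) * Aᵀ =
      Matrix.blockDiagonal' (fun i => t ^ lamb i • U i)) (i : Fin w) (a b : Fin (r i)) :
    t ∣ (blockOf A i i * U i * (blockOf A i i)ᵀ - U i) a b := by
  have hcol := pow_dvd_smul_mul_transpose_blockOf t U lamb hAu hA
  have hlow : ∀ i k, k < i → ∀ a b, t ∣ blockOf A i k a b := by
    intro i k hki a b
    have h1 : ∀ a b, t ∣ (U k * (blockOf A i k)ᵀ) a b := fun a b => by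
      refine hcancel (hle k) ((pow_dvd_pow _ (hmono hki)).trans ?_)
      simpa [Matrix.smul_mul] using hcol i k a b
    have h2 := Matrix.dvd_mul_apply (s := 1) (M := (U k)⁻¹) (fun _ _ => one_dvd _) h1 b a
    rwa [Matrix.nonsing_inv_mul_cancel_left _ _ ((Matrix.isUnit_iff_isUnit_det _).1 (hU k)),
      one_mul] at h2
  refine hcancel (hle i) ?_
  have h := congrArg (fun M => blockOf M i i) hA
  simp only [Matrix.mul_assoc, blockOf_mul A, blockOf_blockDiagonal'_mul,
    blockOf_blockDiagonal'_self, blockOf_transpose] at h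
  rw [← Finset.add_sum_erase _ _ (Finset.mem_univ i)] at h
  have h' : t ^ lamb i * (blockOf A i i * U i * (blockOf A i i)ᵀ - U i) a b =
      -∑ k ∈ Finset.univ.erase i,
        (blockOf A i k * ((t ^ lamb k • U k) * (blockOf A i k)ᵀ)) a b := by
    rw [← Matrix.sum_apply, ← smul_eq_mul, ← Matrix.smul_apply, smul_sub, ← Matrix.neg_apply]
    refine congrArg (fun M : Matrix _ _ R => M a b) ?_
    rw [← h, Matrix.smul_mul, Matrix.mul_smul, Matrix.mul_assoc, sub_add_cancel_left]
  rw [h', dvd_neg]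
  refine Finset.dvd_sum fun k hk => ?_
  rcases lt_or_gt_of_ne (Finset.ne_of_mem_erase hk) with hki | hik
  · rw [pow_succ']
    exact Matrix.dvd_mul_apply (hlow i k hki) (hcol i k) a b
  · rw [Matrix.smul_mul, Matrix.mul_smul, Matrix.smul_apply, smul_eq_mul]
    exact Dvd.dvd.mul_right (pow_dvd_pow _ (hmono hik)) _

end blockOf

/-- If `A D Aᵀ = D` where `D` is block diagonal with blocks `t^{λ̄_1}U_1, …, t^{λ̄_w}U_w`
(the `U_i` invertible over `R_l = ℂ[t]/(t^{l+1})` and `0 ≤ λ̄_1 < ⋯ < λ̄_w ≤ l`), then `A`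
and all its diagonal blocks `A_{ii}` are invertible over `R_l`, and moreover
`A_{ii} U_i A_{ii}ᵀ ≡ U_i` modulo the ideal `(t)`, for every `i`. -/
theorem solASAT_eq_S_part1 (l w : ℕ) (hw : 1 ≤ w) (r : Fin w → ℕ)
    (U : ∀ i : Fin w, Matrix (Fin (r i)) (Fin (r i)) (Rl l))
    (hU : ∀ i, IsUnit (U i))
    (lamb : Fin w → ℕ) (hmono : StrictMono lamb) (hle : ∀ i, lamb i ≤ l)
    (A : Matrix ((i : Fin w) × Fin (r i)) ((i : Fin w) × Fin (r i)) (Rl l))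
    (hA : A * Matrix.blockDiagonal' (fun i => tq l ^ lamb i • U i) * Aᵀ =
        Matrix.blockDiagonal' (fun i => tq l ^ lamb i • U i)) :
    IsUnit A ∧ ∀ i : Fin w, IsUnit (blockOf A i i) ∧
      ∀ a b, tq l ∣ (blockOf A i i * U i * (blockOf A i i)ᵀ - U i) a b := by
  have hAu : IsUnit A := by
    refine Matrix.isUnit_of_mul_mul_eq hA
      (E := Matrix.blockDiagonal' fun i => tq l ^ (l - lamb i) • (U i)⁻¹) ?_
    exact blockDiagonal'_pow_smul_mul (tq l) U hU hle
  have hdiag := dvd_blockOf_mul_mul_transpose_sub (tq l) tq_dvd_of_pow_succ_dvd U hU hmono hle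
    hAu hA
  refine ⟨hAu, fun i => ⟨?_, hdiag i⟩⟩
  refine Matrix.isUnit_of_isUnit_map_constTerm ?_
  have h : (blockOf A i i).map (constTerm l) * (U i).map (constTerm l) *
      ((blockOf A i i)ᵀ).map (constTerm l) = (U i).map (constTerm l) := by
    rw [← Matrix.map_mul, ← Matrix.map_mul]
    ext a b
    rw [Matrix.map_apply, Matrix.map_apply, ← sub_eq_zero, ← map_sub, constTerm_eq_zero_iff]
    exact hdiag i a b
  have hUi : IsUnit ((U i).map (constTerm l)) := (hU i).map (constTerm l).mapMatrix
  rw [← h, Matrix.mul_assoc, Matrix.isUnit_iff_isUnit_det, Matrix.det_mul] at hUi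
  exact (Matrix.isUnit_iff_isUnit_det _).2 (isUnit_of_mul_isUnit_left hUi)

end
end

section
/- Let l ∈ ℤ≥0, R = ℂ[t]/(t^{l+1}), w ≥ 1, let U_1,…,U_w be invertible square matrices over R of sizes r_1,…,r_w, and let 0 ≤ λ̄_1 < λ̄_2 < … < λ̄_w ≤ l be integers. Let D be the block diagonal matrix with blocks t^{λ̄_1}U_1, …, t^{λ̄_w}U_w, and let A be a square matrix over R of size r_1+…+r_w, written in blocks A = (A_{ij})_{1≤i,j≤w} with A_{ij} of size r_i × r_j, such that A D Aᵀ = D. Then for every pair of indices i > j, every entry of the block A_{ij} is divisible by t^{λ̄_i − λ̄_j} in R. -/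
open Matrix

noncomputable section

/-- Multiplication by `A` maps the range of `D` into itself as soon as `A * D * B = D`, by a
dimension count. -/
theorem exists_mulVec_eq_of_mul_mul_eq {n R : Type*} (k : Type*) [Fintype n] [Field k]
    [CommRing R] [Algebra k R] [Module.Finite k R] {A D B : Matrix n n R}
    (h : A * D * B = D) (v : n → R) : ∃ u, A *ᵥ (D *ᵥ v) = D *ᵥ u := by
  let f : (n → R) →ₗ[k] (n → R) := A.mulVecLin.restrictScalars k
  let N : Submodule k (n → R) := LinearMap.range (D.mulVecLin.restrictScalars k)
  have hle : N ≤ N.map f := by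
    rintro _ ⟨u, rfl⟩
    refine ⟨D *ᵥ (B *ᵥ u), ⟨B *ᵥ u, rfl⟩, ?_⟩
    change A *ᵥ (D *ᵥ (B *ᵥ u)) = D *ᵥ u
    rw [mulVec_mulVec, mulVec_mulVec, h]
  have heq : N = N.map f :=
    Submodule.eq_of_le_of_finrank_le hle (Submodule.finrank_map_le f N)
  have hmem : f (D *ᵥ v) ∈ N := heq ▸ Submodule.mem_map_of_mem ⟨v, rfl⟩
  obtain ⟨u, hu⟩ := hmem
  exact ⟨u, hu.symm⟩

/-- The jet ring is finite-dimensional. -/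
theorem finite_Rl (l : ℕ) : Module.Finite ℂ (Rl l) :=
  (Polynomial.monic_X_pow (l + 1)).finite_quotient

/-- Cancelling a power of `t` in a divisibility relation between powers of `t` in the jet ring. -/
theorem tq_pow_sub_dvd_of_dvd_mul {l m n : ℕ} (hm : m ≤ l) (hnm : n ≤ m) {x : Rl l}
    (h : tq l ^ m ∣ x * tq l ^ n) : tq l ^ (m - n) ∣ x := by
  obtain ⟨y, hy⟩ := h
  obtain ⟨p, rfl⟩ := Ideal.Quotient.mk_surjective x
  obtain ⟨q, rfl⟩ := Ideal.Quotient.mk_surjective y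
  simp only [tq, ← map_pow, ← map_mul] at hy ⊢
  rw [Ideal.Quotient.mk_eq_mk_iff_sub_mem, Ideal.mem_span_singleton] at hy
  refine map_dvd _ ?_
  have h1 : (Polynomial.X : Polynomial ℂ) ^ m ∣ p * Polynomial.X ^ n :=
    (dvd_sub_left (dvd_mul_right _ q)).1 ((pow_dvd_pow _ (by omega)).trans hy)
  rw [← Nat.sub_add_cancel hnm, pow_add] at h1
  exact (mul_dvd_mul_iff_right (pow_ne_zero n Polynomial.X_ne_zero)).1 h1

/-- The `i`-th block of a vector in the range of a block diagonal matrix with blocks `c i • U i`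
is divisible by `c i`. -/
theorem dvd_blockDiagonal'_smul_mulVec {o R : Type*} {m : o → Type*} [Fintype o] [DecidableEq o]
    [∀ i, Fintype (m i)] [CommRing R] (c : o → R) (U : ∀ i, Matrix (m i) (m i) R)
    (v : (Σ i, m i) → R) (x : Σ i, m i) :
    c x.1 ∣ (blockDiagonal' (fun i => c i • U i) *ᵥ v) x := by
  refine Finset.dvd_sum fun y _ => Dvd.dvd.mul_right ?_ _
  change _ ∣ blockDiagonal' _ x y
  rw [blockDiagonal'_apply]
  split_ifs with h
  · exact dvd_mul_right _ _
  · exact dvd_zero _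

/-- If `A * D * B = D` with `D` block diagonal with blocks `c i • U i`, the `U i` invertible, then
`c i` divides `c j` times each entry of the `(i, j)` block of `A`. -/
theorem dvd_apply_mul_of_mul_blockDiagonal'_smul_mul_eq {o R : Type*} {m : o → Type*} (k : Type*)
    [Fintype o] [DecidableEq o] [∀ i, Fintype (m i)] [∀ i, DecidableEq (m i)] [Field k]
    [CommRing R] [Algebra k R] [Module.Finite k R] (c : o → R) (U : ∀ i, Matrix (m i) (m i) R)
    (hU : ∀ i, IsUnit (U i)) {A B : Matrix (Σ i, m i) (Σ i, m i) R}
    (h : A * blockDiagonal' (fun i => c i • U i) * B = blockDiagonal' (fun i => c i • U i))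
    (x y : Σ i, m i) : c x.1 ∣ A x y * c y.1 := by
  have hT : blockDiagonal' (fun i => c i • U i) * blockDiagonal' (fun i => (U i)⁻¹) =
      diagonal fun z : Σ i, m i => c z.1 := by
    rw [← blockDiagonal'_mul, ← blockDiagonal'_diagonal fun (i : o) (_ : m i) => c i]
    congr 1
    ext1 i
    rw [smul_mul, mul_nonsing_inv _ ((isUnit_iff_isUnit_det _).1 (hU i)), smul_one_eq_diagonal]
  obtain ⟨u, hu⟩ := exists_mulVec_eq_of_mul_mul_eq k h
    (blockDiagonal' (fun i => (U i)⁻¹) *ᵥ Pi.single y 1)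
  have hentry : A x y * c y.1 = (blockDiagonal' (fun i => c i • U i) *ᵥ u) x := by
    rw [← hu, mulVec_mulVec _ (blockDiagonal' fun i => c i • U i), hT, mulVec_mulVec,
      mulVec_single_one, col_apply, mul_diagonal]
  rw [hentry]
  exact dvd_blockDiagonal'_smul_mulVec c U u x

/-- If `A D Aᵀ = D` where `D` is block diagonal with blocks `t^{λ̄_1}U_1, …, t^{λ̄_w}U_w`
(the `U_i` invertible over `R_l = ℂ[t]/(t^{l+1})` and `0 ≤ λ̄_1 < ⋯ < λ̄_w ≤ l`), then for
all `i > j` every entry of the block `A_{ij}` is divisible by `t^{λ̄_i − λ̄_j}` in `R_l`. -/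
theorem solASAT_eq_S_part2 (l w : ℕ) (hw : 1 ≤ w) (r : Fin w → ℕ)
    (U : ∀ i : Fin w, Matrix (Fin (r i)) (Fin (r i)) (Rl l))
    (hU : ∀ i, IsUnit (U i))
    (lamb : Fin w → ℕ) (hmono : StrictMono lamb) (hle : ∀ i, lamb i ≤ l)
    (A : Matrix ((i : Fin w) × Fin (r i)) ((i : Fin w) × Fin (r i)) (Rl l))
    (hA : A * Matrix.blockDiagonal' (fun i => tq l ^ lamb i • U i) * Aᵀ =
        Matrix.blockDiagonal' (fun i => tq l ^ lamb i • U i)) :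
    ∀ i j : Fin w, j < i → ∀ a b, tq l ^ (lamb i - lamb j) ∣ blockOf A i j a b := by
  intro i j hij a b
  have := finite_Rl l
  refine tq_pow_sub_dvd_of_dvd_mul (hle i) (hmono hij).le ?_
  exact dvd_apply_mul_of_mul_blockDiagonal'_smul_mul_eq ℂ (fun i => tq l ^ lamb i) U hU hA
    ⟨i, a⟩ ⟨j, b⟩

end
end

section
/- Let q ≥ 2, let H = (h_{ij}) be a q×q skew-symmetric complex matrix, let 1 ≤ r ≤ k ≤ ⌊q/2⌋ be integers, and let a ∈ ℂ be nonzero. Call a subset I ⊆ {1,…,q} with |I| = 2r 'special' if I = {2k_1−1, 2k_1, 2k_2−1, 2k_2, …, 2k_r−1, 2k_r} for some integers 1 ≤ k_1 < k_2 < … < k_r ≤ k. Suppose that Pf(H_I) = a for every special subset I, and Pf(H_I) = 0 for every non-special subset I ⊆ {1,…,q} with |I| = 2r, where H_I is the principal submatrix of H on rows and columns I. Then h_{ij} = 0 whenever i > 2k or j > 2k; that is, H has block form [[H', 0],[0, 0]] for some 2k×2k skew-symmetric matrix H'. -/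
open Matrix

noncomputable section

/-- The Pfaffian of a `2r × 2r` matrix over a commutative `ℚ`-algebra, via the formula
`Pf(A) = (1/(2^r r!)) Σ_{σ ∈ S_{2r}} sgn(σ) Π_{s=1}^{r} a_{σ(2s-1), σ(2s)}`. -/
def pfaffian {R : Type*} [CommRing R] [Algebra ℚ R] {r : ℕ}
    (A : Matrix (Fin (2 * r)) (Fin (2 * r)) R) : R :=
  algebraMap ℚ R (1 / (2 ^ r * (Nat.factorial r : ℚ))) *
    ∑ σ : Equiv.Perm (Fin (2 * r)),
      (Equiv.Perm.sign σ : ℤ) •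
        ∏ s : Fin r,
          A (σ ⟨2 * (s : ℕ), by have := s.isLt; omega⟩)
            (σ ⟨2 * (s : ℕ) + 1, by have := s.isLt; omega⟩)

/-- The principal submatrix of `H` on the rows and columns indexed by a subset `I` of
cardinality `2r`, via the monotone enumeration of `I`. -/
def psub {m r : ℕ} {R : Type*} (H : Matrix (Fin m) (Fin m) R) (I : Finset (Fin m))
    (h : I.card = 2 * r) : Matrix (Fin (2 * r)) (Fin (2 * r)) R :=
  H.submatrix (fun s => ((I.orderIsoOfFin h) s : Fin m))
    (fun s => ((I.orderIsoOfFin h) s : Fin m))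

/-- A subset `I ⊆ {1,…,q}` with `|I| = 2r` is special if
`I = {2k_1−1, 2k_1, …, 2k_r−1, 2k_r}` for some `1 ≤ k_1 < ⋯ < k_r ≤ k`; in 0-based
indexing, membership in `I` depends only on `⌊x/2⌋` lying in an `r`-element subset of
`{0,…,k−1}`. -/
def SpecialSet (q k r : ℕ) (I : Finset (Fin q)) : Prop :=
  ∃ K : Finset ℕ, K ⊆ Finset.range k ∧ K.card = r ∧
    ∀ x : Fin q, x ∈ I ↔ (x : ℕ) / 2 ∈ K

theorem exists_eq_two_mul_or_two_mul_add_one {r : ℕ} (t : Fin (2 * r)) :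
    ∃ s : Fin r, t = ⟨2 * (s : ℕ), by have := s.isLt; omega⟩ ∨
      t = ⟨2 * (s : ℕ) + 1, by have := s.isLt; omega⟩ := by
  refine ⟨⟨t / 2, by have := t.isLt; omega⟩, ?_⟩
  simp only [Fin.ext_iff]
  omega

/-- Functions on `Fin (2 * r)` correspond to families of pairs indexed by `Fin r`. -/
theorem bijective_pairs (r : ℕ) (α : Type*) :
    Function.Bijective (fun (f : Fin (2 * r) → α) (s : Fin r) =>
      (f ⟨2 * (s : ℕ), by have := s.isLt; omega⟩,
        f ⟨2 * (s : ℕ) + 1, by have := s.isLt; omega⟩)) := by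
  constructor
  · intro f g h
    funext t
    obtain ⟨s, rfl | rfl⟩ := exists_eq_two_mul_or_two_mul_add_one t
    · exact congrArg Prod.fst (congrFun h s)
    · exact congrArg Prod.snd (congrFun h s)
  · intro p
    refine ⟨fun t => if (t : ℕ) % 2 = 0 then (p ⟨t / 2, by have := t.isLt; omega⟩).1
      else (p ⟨t / 2, by have := t.isLt; omega⟩).2, ?_⟩
    funext s
    have h : (2 * (s : ℕ) + 1) / 2 = s := by omega
    simp [h, Nat.add_mod]

theorem prod_pairs {R : Type*} [CommMonoid R] {r : ℕ} (f : Fin (2 * r) → R) :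
    ∏ t, f t = ∏ s : Fin r, f ⟨2 * (s : ℕ), by have := s.isLt; omega⟩ *
      f ⟨2 * (s : ℕ) + 1, by have := s.isLt; omega⟩ := by
  rw [← (finProdFinEquiv.trans (finCongr (mul_comm r 2))).prod_comp, Fintype.prod_prod_type]
  refine Finset.prod_congr rfl fun s _ => ?_
  rw [Fin.prod_univ_two]
  congr 2 <;> simp [Fin.ext_iff, add_comm]

theorem pfaffian_submatrix_perm {R : Type*} [CommRing R] [Algebra ℚ R] {r : ℕ}
    (A : Matrix (Fin (2 * r)) (Fin (2 * r)) R) (τ : Equiv.Perm (Fin (2 * r))) :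
    pfaffian (A.submatrix τ τ) = (Equiv.Perm.sign τ : ℤ) • pfaffian A := by
  unfold pfaffian
  rw [← mul_smul_comm]
  congr 1
  rw [← Equiv.sum_comp (Equiv.mulLeft τ) (fun σ : Equiv.Perm (Fin (2 * r)) =>
    (Equiv.Perm.sign σ : ℤ) • ∏ s : Fin r, A (σ ⟨2 * (s : ℕ), by have := s.isLt; omega⟩)
      (σ ⟨2 * (s : ℕ) + 1, by have := s.isLt; omega⟩)), Finset.smul_sum]
  refine Finset.sum_congr rfl fun σ _ => ?_
  rw [smul_smul]
  congr 1
  simp [← mul_assoc, ← Units.val_mul]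

theorem pfaffian_eq_zero_of_row_col {R : Type*} [CommRing R] [Algebra ℚ R] {r : ℕ}
    (A : Matrix (Fin (2 * r)) (Fin (2 * r)) R) (m : Fin (2 * r))
    (hrow : ∀ n, A m n = 0) (hcol : ∀ n, A n m = 0) : pfaffian A = 0 := by
  unfold pfaffian
  rw [Finset.sum_eq_zero, mul_zero]
  intro σ _
  obtain ⟨s, hs⟩ := exists_eq_two_mul_or_two_mul_add_one (σ.symm m)
  rw [Finset.prod_eq_zero (Finset.mem_univ s), smul_zero]
  rcases hs with hs | hs
  · rw [← hs, Equiv.apply_symm_apply, hrow]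
  · rw [← hs, Equiv.apply_symm_apply, hcol]

/-- An unsigned expansion of the Pfaffian of a congruence transform. -/
theorem pfaffian_mul_mul_transpose_eq_sum_prod {R : Type*} [CommRing R] [Algebra ℚ R] {r q : ℕ}
    (B : Matrix (Fin (2 * r)) (Fin q) R) (H : Matrix (Fin q) (Fin q) R) :
    pfaffian (B * H * Bᵀ) = algebraMap ℚ R (1 / (2 ^ r * (Nat.factorial r : ℚ))) *
      ∑ f : Fin (2 * r) → Fin q, (B.submatrix id f).det *
        ∏ s : Fin r, H (f ⟨2 * (s : ℕ), by have := s.isLt; omega⟩)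
          (f ⟨2 * (s : ℕ) + 1, by have := s.isLt; omega⟩) := by
  unfold pfaffian
  congr 1
  simp only [det_apply, Finset.sum_mul]
  rw [Finset.sum_comm]
  refine Finset.sum_congr rfl fun σ _ => ?_
  have hentry : ∀ i j, (B * H * Bᵀ) i j = ∑ p : Fin q × Fin q, B i p.1 * B j p.2 * H p.1 p.2 := by
    intro i j
    rw [Fintype.sum_prod_type, Finset.sum_comm]
    simp only [mul_apply, transpose_apply, Finset.sum_mul]
    refine Finset.sum_congr rfl fun _ _ => Finset.sum_congr rfl fun _ _ => by ring
  simp only [hentry]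
  rw [Finset.prod_univ_sum, Fintype.piFinset_univ, ← (bijective_pairs r (Fin q)).sum_comp,
    Finset.smul_sum]
  refine Finset.sum_congr rfl fun f _ => ?_
  rw [prod_pairs, smul_mul_assoc, ← Finset.prod_mul_distrib]
  rfl

/-- The Cauchy–Binet formula for Pfaffians, summed over all functions. -/
theorem factorial_mul_pfaffian_mul_mul_transpose {R : Type*} [CommRing R] [Algebra ℚ R] {r q : ℕ}
    (B : Matrix (Fin (2 * r)) (Fin q) R) (H : Matrix (Fin q) (Fin q) R) :
    ((2 * r).factorial : R) * pfaffian (B * H * Bᵀ) =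
      ∑ f : Fin (2 * r) → Fin q, (B.submatrix id f).det * pfaffian (H.submatrix f f) := by
  have hcard : ((2 * r).factorial : R) * pfaffian (B * H * Bᵀ) =
      ∑ _τ : Equiv.Perm (Fin (2 * r)), pfaffian (B * H * Bᵀ) := by
    simp [Fintype.card_perm]
  rw [hcard]
  simp only [pfaffian_mul_mul_transpose_eq_sum_prod]
  simp only [pfaffian, mul_left_comm _ (algebraMap ℚ R _), ← Finset.mul_sum]
  congr 1
  simp only [Finset.mul_sum]
  rw [Finset.sum_comm' (s := Finset.univ) (t := fun _ => Finset.univ) (t' := Finset.univ)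
    (s' := fun _ => Finset.univ) (by simp)]
  rw [Finset.sum_comm]
  conv_rhs => rw [Finset.sum_comm]
  refine Finset.sum_congr rfl fun τ _ => ?_
  rw [← (Equiv.arrowCongr τ.symm (Equiv.refl (Fin q))).sum_comp]
  refine Finset.sum_congr rfl fun f _ => ?_
  have hdet : (B.submatrix id (Equiv.arrowCongr τ.symm (Equiv.refl (Fin q)) f)).det =
      (Equiv.Perm.sign τ : ℤ) • (B.submatrix id f).det := by
    rw [zsmul_eq_mul, ← det_permute']
    rfl
  rw [hdet, smul_mul_assoc, mul_smul_comm]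
  rfl

/-- The Pfaffian along an injective enumeration agrees up to sign with that of `psub`. -/
theorem exists_pfaffian_submatrix_eq_smul_psub {R : Type*} [CommRing R] [Algebra ℚ R] {r q : ℕ}
    (H : Matrix (Fin q) (Fin q) R) (f : Fin (2 * r) → Fin q) (hf : f.Injective)
    (I : Finset (Fin q)) (hI : I.card = 2 * r) (hfI : ∀ t, f t ∈ I) :
    ∃ n : ℤ, pfaffian (H.submatrix f f) = n • pfaffian (psub H I hI) := by
  have hbij : Function.Bijective (fun t => (I.orderIsoOfFin hI).symm ⟨f t, hfI t⟩) := by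
    rw [← Finite.injective_iff_bijective]
    intro s t hst
    simpa [hf.eq_iff] using hst
  refine ⟨_, Eq.trans ?_ (pfaffian_submatrix_perm (psub H I hI) (Equiv.ofBijective _ hbij))⟩
  congr 1
  ext s t
  simp [psub, -Finset.coe_orderIsoOfFin_apply]

theorem SpecialSet.lt {q k r : ℕ} {I : Finset (Fin q)} (hI : SpecialSet q k r I) {x : Fin q}
    (hx : x ∈ I) : (x : ℕ) < 2 * k := by
  obtain ⟨K, hK, -, hmem⟩ := hI
  have := Finset.mem_range.1 (hK ((hmem x).1 hx))
  omega

theorem exists_specialSet {q r k : ℕ} (hr : 1 ≤ r) (hrk : r ≤ k) (hkq : 2 * k ≤ q) {i : ℕ}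
    (hi : i < 2 * k) :
    ∃ I : Finset (Fin q), I.card = 2 * r ∧ SpecialSet q k r I ∧ ⟨i, by omega⟩ ∈ I := by
  obtain ⟨K, hiK, hK, hcard⟩ := Finset.exists_subsuperset_card_eq
    (s := {i / 2}) (t := Finset.range k) (n := r) (by simp; omega) (by simpa) (by simpa)
  refine ⟨Finset.univ.filter fun x => (x : ℕ) / 2 ∈ K, ?_, ⟨K, hK, hcard, by simp⟩,
    by simpa using hiK⟩
  rw [← hcard, mul_comm, Finset.card_eq_sum_card_fiberwise (f := fun x : Fin q => (x : ℕ) / 2)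
    (t := K) (by intro x; simp)]
  refine Finset.sum_const_nat fun c hc => ?_
  have hck := Finset.mem_range.1 (hK hc)
  rw [Finset.card_eq_two]
  refine ⟨⟨2 * c, by omega⟩, ⟨2 * c + 1, by omega⟩, by simp, ?_⟩
  ext x
  simp only [Finset.mem_filter, Finset.mem_univ, true_and, Finset.mem_insert,
    Finset.mem_singleton, Fin.ext_iff]
  constructor
  · rintro ⟨-, h⟩
    omega
  · intro h
    have : (x : ℕ) / 2 = c := by omega
    exact ⟨this ▸ hc, this⟩

/-- If the Pfaffians of all principal `2r × 2r` submatrices meeting the columns outside `S`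
vanish, then the Pfaffian of `B * H * Bᵀ` depends only on the columns of `B` in `S`. -/
theorem pfaffian_mul_mul_transpose_congr {r q : ℕ} {H : Matrix (Fin q) (Fin q) ℂ}
    {S : Set (Fin q)} (hS : ∀ (I : Finset (Fin q)) (h : I.card = 2 * r),
      ¬ (I : Set (Fin q)) ⊆ S → pfaffian (psub H I h) = 0)
    {B B' : Matrix (Fin (2 * r)) (Fin q) ℂ} (hB : ∀ t, ∀ x ∈ S, B t x = B' t x) :
    pfaffian (B * H * Bᵀ) = pfaffian (B' * H * B'ᵀ) := by
  refine mul_left_cancel₀ (Nat.cast_ne_zero.2 (Nat.factorial_ne_zero (2 * r))) ?_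
  rw [factorial_mul_pfaffian_mul_mul_transpose, factorial_mul_pfaffian_mul_mul_transpose]
  refine Finset.sum_congr rfl fun f _ => ?_
  by_cases hfS : ∀ t, f t ∈ S
  · congr 2
    ext s t
    exact hB s _ (hfS t)
  by_cases hf : f.Injective
  · have hcard : (Finset.univ.image f).card = 2 * r := by
      rw [Finset.card_image_of_injective _ hf, Finset.card_fin]
    obtain ⟨n, hn⟩ := exists_pfaffian_submatrix_eq_smul_psub H f hf _ hcard (by simp)
    rw [hn, hS _ hcard (by simpa [Set.range_subset_iff] using hfS)]
    simp
  · obtain ⟨s, t, hst, hne⟩ : ∃ s t, f s = f t ∧ s ≠ t := by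
      simpa [Function.Injective] using hf
    rw [det_zero_of_column_eq hne (by simp [hst]), det_zero_of_column_eq hne (by simp [hst])]

/-- If adding multiples of the `j`-th coordinate to the rows of `B` never changes the nonzero
Pfaffian of `B * H * Bᵀ`, then the `j`-th column of `B * H` vanishes. -/
theorem mul_apply_eq_zero_of_pfaffian_ne_zero {r q : ℕ} {H : Matrix (Fin q) (Fin q) ℂ}
    (hH : Hᵀ = -H) (B : Matrix (Fin (2 * r)) (Fin q) ℂ) (j : Fin q)
    (hB : ∀ x : Fin (2 * r) → ℂ, pfaffian ((B + vecMulVec x (Pi.single j 1)) * H *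
      (B + vecMulVec x (Pi.single j 1))ᵀ) ≠ 0) (m : Fin (2 * r)) : (B * H) m j = 0 := by
  by_contra hb
  have hskew : ∀ C : Matrix (Fin (2 * r)) (Fin q) ℂ, (C * H * Cᵀ)ᵀ = -(C * H * Cᵀ) := by
    intro C
    simp [transpose_mul, hH, Matrix.mul_assoc]
  have happ : ∀ (C : Matrix (Fin (2 * r)) (Fin q) ℂ) (s t), (C * H * Cᵀ) s t =
      -(C * H * Cᵀ) t s := fun C s t => congrFun (congrFun (hskew C) t) s
  have hjj : H j j = 0 := self_eq_neg.1 (congrFun (congrFun hH j) j)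
  set N := B * H * Bᵀ with hN
  have hcol : ∀ (x : Fin (2 * r) → ℂ) (n), ((B + vecMulVec x (Pi.single j 1)) * H *
      (B + vecMulVec x (Pi.single j 1))ᵀ) n m =
      N n m + (B * H) n j * x m - x n * (B * H) m j := by
    intro x n
    have hHB : (H * Bᵀ) j m = -(B * H) m j := by
      have : H * Bᵀ = -(B * H)ᵀ := by simp [transpose_mul, hH]
      rw [this]
      rfl
    have hHj : (H.row j ᵥ* Bᵀ) m = -(B * H) m j := hHB
    simp only [Matrix.add_mul, Matrix.mul_add, transpose_add, transpose_vecMulVec, vecMulVec_mul,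
      mul_vecMulVec, Matrix.add_apply, vecMulVec_apply, hN, single_one_vecMul, mulVec_single_one,
      col_apply, row_apply, hHj, hjj]
    ring
  have hNm : N m m = 0 := self_eq_neg.1 (happ B m m)
  have hzero : ∀ n, ((B + vecMulVec (fun n => N n m / (B * H) m j) (Pi.single j 1)) * H *
      (B + vecMulVec (fun n => N n m / (B * H) m j) (Pi.single j 1))ᵀ) n m = 0 := by
    intro n
    rw [hcol, hNm]
    field_simp
    ring
  refine hB _ (pfaffian_eq_zero_of_row_col _ m (fun n => ?_) hzero)
  rw [happ, hzero, neg_zero]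

/-- If all Pfaffians of principal `2r × 2r` submatrices of a skew-symmetric `H` on special
subsets equal a fixed `a ≠ 0` and all others vanish, then `h_{ij} = 0` whenever `i > 2k`
or `j > 2k` (1-based); i.e. `H = [[H', 0],[0, 0]]` with `H'` of size `2k × 2k`. -/
theorem pfaffian_support_lemma (q r k : ℕ) (hq : 2 ≤ q)
    (H : Matrix (Fin q) (Fin q) ℂ) (hH : Hᵀ = -H)
    (hr : 1 ≤ r) (hrk : r ≤ k) (hkq : 2 * k ≤ q)
    (a : ℂ) (ha : a ≠ 0)
    (hspec : ∀ (I : Finset (Fin q)) (h : I.card = 2 * r),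
      SpecialSet q k r I → pfaffian (psub H I h) = a)
    (hnonspec : ∀ (I : Finset (Fin q)) (h : I.card = 2 * r),
      ¬SpecialSet q k r I → pfaffian (psub H I h) = 0) :
    ∀ i j : Fin q, 2 * k ≤ (i : ℕ) ∨ 2 * k ≤ (j : ℕ) → H i j = 0 := by
  have key : ∀ (I : Finset (Fin q)), I.card = 2 * r → SpecialSet q k r I → ∀ j : Fin q,
      2 * k ≤ (j : ℕ) → (∀ i ∈ I, H i j = 0) ∧ ∀ i : Fin q, 2 * k ≤ (i : ℕ) → H i j = 0 := by
    intro I hI hspecI j hj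
    set g : Fin (2 * r) → Fin q := fun s => (I.orderIsoOfFin hI s : Fin q) with hg
    set E : Matrix (Fin (2 * r)) (Fin q) ℂ := (1 : Matrix (Fin q) (Fin q) ℂ).submatrix g id with hE
    have hEH : E * H * Eᵀ = psub H I hI := by
      ext s t
      simp [hE, psub, mul_apply, one_apply, hg]
    have hEH' : ∀ s, (E * H) s j = H (g s) j := by
      intro s
      simp [hE, mul_apply, one_apply]
    have hpf : ∀ B : Matrix (Fin (2 * r)) (Fin q) ℂ,
        (∀ t, ∀ x ∈ {x : Fin q | (x : ℕ) < 2 * k}, B t x = E t x) →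
        pfaffian (B * H * Bᵀ) ≠ 0 := by
      intro B hB
      rw [pfaffian_mul_mul_transpose_congr (fun J hJ hsub => hnonspec J hJ fun h =>
        hsub fun x hx => h.lt hx) hB, hEH, hspec I hI hspecI]
      exact ha
    have hrow : ∀ s, H (g s) j = 0 := by
      intro s
      rw [← hEH']
      refine mul_apply_eq_zero_of_pfaffian_ne_zero hH E j (fun x => hpf _ fun t y hy => ?_) s
      have : y ≠ j := by rintro rfl; exact absurd hy (not_lt.2 hj)
      simp [vecMulVec_apply, this]
    refine ⟨fun i hi => ?_, fun i hi => ?_⟩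
    · simpa [hg, -Finset.coe_orderIsoOfFin_apply] using hrow ((I.orderIsoOfFin hI).symm ⟨i, hi⟩)
    · have h := mul_apply_eq_zero_of_pfaffian_ne_zero hH (E + vecMulVec 1 (Pi.single i 1)) j
        (fun x => hpf _ fun t y hy => ?_) ⟨0, by omega⟩
      · rwa [Matrix.add_mul, Matrix.add_apply, hEH', hrow, zero_add, vecMulVec_mul, vecMulVec_apply,
          single_one_vecMul, Pi.one_apply, one_mul] at h
      · have hyj : y ≠ j := by rintro rfl; exact absurd hy (not_lt.2 hj)
        have hyi : y ≠ i := by rintro rfl; exact absurd hy (not_lt.2 hi)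
        simp [vecMulVec_apply, hyj, hyi]
  have hcol : ∀ i j : Fin q, 2 * k ≤ (j : ℕ) → H i j = 0 := by
    intro i j hj
    rcases lt_or_ge (i : ℕ) (2 * k) with hi | hi
    · obtain ⟨I, hI, hspecI, hiI⟩ := exists_specialSet hr hrk hkq hi
      exact (key I hI hspecI j hj).1 i hiI
    · obtain ⟨I, hI, hspecI, -⟩ := exists_specialSet hr hrk hkq (i := 0) (by omega)
      exact (key I hI hspecI j hj).2 i hi
  rintro i j (hi | hj)
  · have h : H i j = -H j i := congrFun (congrFun hH j) i
    rw [h, hcol j i hi, neg_zero]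
  · exact hcol i j hj

end
end

section
/- Let q ≥ 2, let H = (h_{ij}) be a q×q skew-symmetric complex matrix, let 1 ≤ r < k ≤ ⌊q/2⌋ be integers (so k > r), and let a ∈ ℂ be nonzero. Call a subset I ⊆ {1,…,q} with |I| = 2r 'special' if I = {2k_1−1, 2k_1, 2k_2−1, 2k_2, …, 2k_r−1, 2k_r} for some integers 1 ≤ k_1 < k_2 < … < k_r ≤ k. Suppose that Pf(H_I) = a for every special subset I, and Pf(H_I) = 0 for every non-special subset I ⊆ {1,…,q} with |I| = 2r, where H_I is the principal submatrix of H on rows and columns I. Then there exists a nonzero c ∈ ℂ such that H equals c times the q×q block diagonal matrix with k copies of J = [[0,1],[-1,0]] followed by the (q−2k)×(q−2k) zero matrix. -/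
open Matrix

noncomputable section

/-- The `q × q` matrix which is block diagonal with `k` copies of `J = [[0,1],[-1,0]]`
followed by a `(q−2k) × (q−2k)` zero block. -/
def Sblock (q k : ℕ) : Matrix (Fin q) (Fin q) ℂ :=
  Matrix.of fun i j =>
    if (i : ℕ) / 2 = (j : ℕ) / 2 ∧ (i : ℕ) / 2 < k then
      (if (i : ℕ) % 2 = 0 ∧ (j : ℕ) % 2 = 1 then 1
       else if (i : ℕ) % 2 = 1 ∧ (j : ℕ) % 2 = 0 then -1 else 0)
    else 0

/-- The unnormalised Pfaffian of the (possibly non-injective) tuple of indices `x`. -/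
def pfSum {ι R : Type*} [CommRing R] {n : ℕ} (H : ι → ι → R) (x : Fin (2 * n) → ι) : R :=
  ∑ σ : Equiv.Perm (Fin (2 * n)),
    (Equiv.Perm.sign σ : ℤ) •
      ∏ s : Fin n, H (x (σ ⟨2 * (s : ℕ), by omega⟩)) (x (σ ⟨2 * (s : ℕ) + 1, by omega⟩))

section PfSum

variable {ι R : Type*} [CommRing R] {n : ℕ} (H : ι → ι → R)

theorem pfaffian_psub {q r : ℕ} (H : Fin q → Fin q → ℂ) (I : Finset (Fin q))
    (h : I.card = 2 * r) :
    pfaffian (psub (Matrix.of H) I h) =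
      (1 / (2 ^ r * (r.factorial : ℂ))) * pfSum H (I.orderEmbOfFin h) := by
  simp [pfaffian, pfSum, psub]

theorem pfSum_comp_perm (x : Fin (2 * n) → ι) (τ : Equiv.Perm (Fin (2 * n))) :
    pfSum H (x ∘ τ) = (Equiv.Perm.sign τ : ℤ) • pfSum H x := by
  unfold pfSum
  rw [Finset.smul_sum]
  refine Fintype.sum_equiv (Equiv.mulLeft τ) _ _ fun σ => ?_
  rw [smul_smul]
  congr 1
  simp [← mul_assoc, ← Units.val_mul]

theorem pfSum_eq_zero_of_not_injective [NoZeroDivisors R] [CharZero R] {x : Fin (2 * n) → ι}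
    (hx : ¬ Function.Injective x) : pfSum H x = 0 := by
  simp only [Function.Injective, not_forall] at hx
  obtain ⟨u, v, huv, hne⟩ := hx
  have hswap : x ∘ Equiv.swap u v = x := by
    funext w
    simp only [Function.comp_apply, Equiv.swap_apply_def]
    split_ifs with h1 h2
    · rw [h1, huv]
    · rw [h2, huv]
    · rfl
  have key := pfSum_comp_perm H x (Equiv.swap u v)
  rw [hswap, Equiv.Perm.sign_swap hne] at key
  simpa [self_eq_neg] using key

theorem exists_perm_eq_comp {α β : Type*} {f g : α → β} (hf : Function.Injective f)
    (hg : Function.Injective g) (hfg : Set.range f = Set.range g) :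
    ∃ τ : Equiv.Perm α, f = g ∘ τ := by
  refine ⟨(Equiv.ofInjective f hf).trans
    ((Equiv.setCongr hfg).trans (Equiv.ofInjective g hg).symm), ?_⟩
  funext a
  simp [Equiv.apply_ofInjective_symm]

/-- Permuting the consecutive pairs `{2s, 2s+1}` is an even permutation. -/
theorem exists_perm_of_pairs (τ : Equiv.Perm (Fin n)) :
    ∃ ρ : Equiv.Perm (Fin (2 * n)), Equiv.Perm.sign ρ = 1 ∧
      ∀ (s : Fin n) (b : ℕ) (hb : b < 2),
        ρ ⟨2 * (s : ℕ) + b, by omega⟩ = ⟨2 * (τ s : ℕ) + b, by omega⟩ := by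
  let e : Fin n × Fin 2 ≃ Fin (2 * n) := finProdFinEquiv.trans (finCongr (mul_comm n 2))
  have he : ∀ (s : Fin n) (b : ℕ) (hb : b < 2),
      (⟨2 * (s : ℕ) + b, by omega⟩ : Fin (2 * n)) = e (s, ⟨b, hb⟩) := by
    intro s b hb
    ext
    simp [e, add_comm]
  refine ⟨e.permCongr (Equiv.prodCongrLeft fun _ => τ), ?_, ?_⟩
  · rw [Equiv.Perm.sign_permCongr, Equiv.Perm.sign_prodCongrLeft]
    simp
  · intro s b hb
    rw [he s b hb, he (τ s) b hb]
    simp [Equiv.permCongr_apply]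

/-- The signed product attached to a permutation in `pfSum`. -/
def pfTerm (x : Fin (2 * n) → ι) (σ : Equiv.Perm (Fin (2 * n))) : R :=
  (Equiv.Perm.sign σ : ℤ) •
    ∏ s : Fin n, H (x (σ ⟨2 * (s : ℕ), by omega⟩)) (x (σ ⟨2 * (s : ℕ) + 1, by omega⟩))

/-- Any position can be moved to the front without changing the terms of `pfSum`. -/
theorem exists_perm_pfTerm_mul (hH : ∀ i j, H i j = -H j i) (x : Fin (2 * (n + 1)) → ι)
    (u : Fin (2 * (n + 1))) :
    ∃ ρ : Equiv.Perm (Fin (2 * (n + 1))), ρ 0 = u ∧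
      ∀ σ, pfTerm H x (σ * ρ) = pfTerm H x σ := by
  obtain ⟨ρ, hsign, hρ⟩ :=
    exists_perm_of_pairs (Equiv.swap (0 : Fin (n + 1)) ⟨(u : ℕ) / 2, by omega⟩)
  have hblock : ∀ σ, pfTerm H x (σ * ρ) = pfTerm H x σ := by
    intro σ
    unfold pfTerm
    rw [Equiv.Perm.sign_mul, hsign, mul_one]
    congr 1
    refine Fintype.prod_equiv (Equiv.swap (0 : Fin (n + 1)) ⟨(u : ℕ) / 2, by omega⟩) _ _
      fun s => ?_
    have h0 := hρ s 0 (by norm_num)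
    have h1 := hρ s 1 (by norm_num)
    simp only [add_zero] at h0
    rw [Equiv.Perm.mul_apply, Equiv.Perm.mul_apply, h0, h1]
  rcases Nat.mod_two_eq_zero_or_one (u : ℕ) with hu | hu
  · refine ⟨ρ, ?_, hblock⟩
    have h0 := hρ 0 0 (by norm_num)
    simp only [Equiv.swap_apply_left] at h0
    refine Eq.trans h0 (Fin.ext ?_)
    simp only
    omega
  · have hne : (0 : Fin (2 * (n + 1))) ≠ ⟨1, by omega⟩ := by
      simp
    refine ⟨ρ * Equiv.swap 0 ⟨1, by omega⟩, ?_, fun σ => ?_⟩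
    · have h0 := hρ 0 1 (by norm_num)
      simp only [Equiv.swap_apply_left] at h0
      rw [Equiv.Perm.mul_apply, Equiv.swap_apply_left]
      refine Eq.trans h0 (Fin.ext ?_)
      simp only
      omega
    · rw [← mul_assoc, ← hblock σ]
      generalize σ * ρ = σ'
      unfold pfTerm
      rw [Equiv.Perm.sign_mul, Equiv.Perm.sign_swap hne, Fin.prod_univ_succ, Fin.prod_univ_succ]
      have hrest : ∀ v : Fin (2 * (n + 1)), 2 ≤ (v : ℕ) →
          (Equiv.swap (0 : Fin (2 * (n + 1))) ⟨1, by omega⟩) v = v := by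
        intro v hv
        apply Equiv.swap_apply_of_ne_of_ne <;> simp only [ne_eq, Fin.ext_iff, Fin.val_zero] <;>
          omega
      have h0 : (⟨2 * ((0 : Fin (n + 1)) : ℕ), by simp⟩ : Fin (2 * (n + 1))) = 0 := rfl
      have h1 : (⟨2 * ((0 : Fin (n + 1)) : ℕ) + 1, by simp; omega⟩ : Fin (2 * (n + 1))) =
        ⟨1, by omega⟩ := rfl
      rw [h0, h1]
      simp only [Equiv.Perm.mul_apply, Equiv.swap_apply_left, Equiv.swap_apply_right]
      have h2 : ∀ s : Fin n, (Equiv.swap (0 : Fin (2 * (n + 1))) ⟨1, by omega⟩)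
          ⟨2 * (s.succ : ℕ), by omega⟩ = ⟨2 * (s.succ : ℕ), by omega⟩ :=
        fun s => hrest _ (by simp only [Fin.val_succ]; omega)
      have h3 : ∀ s : Fin n, (Equiv.swap (0 : Fin (2 * (n + 1))) ⟨1, by omega⟩)
          ⟨2 * (s.succ : ℕ) + 1, by omega⟩ = ⟨2 * (s.succ : ℕ) + 1, by omega⟩ :=
        fun s => hrest _ (by simp only [Fin.val_succ]; omega)
      simp only [h2, h3]
      rw [hH (x (σ' ⟨1, _⟩))]
      simp

/-- Expansion of the Pfaffian along the first row. -/
theorem pfSum_succ (hH : ∀ i j, H i j = -H j i) (x : Fin (2 * (n + 1)) → ι) :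
    pfSum H x = (2 * (n + 1) : ℕ) * ∑ p : Fin (2 * n + 1), (if p = 0 then 1 else -1) *
      (H (x 0) (x (Fin.succ p)) *
        pfSum H fun t : Fin (2 * n) => x (Fin.succ (Equiv.swap 0 p (Fin.succ t)))) := by
  have hpos : ∀ u : Fin (2 * (n + 1)),
      ∑ σ : Equiv.Perm (Fin (2 * (n + 1))), (if σ u = 0 then pfTerm H x σ else 0) =
      ∑ σ : Equiv.Perm (Fin (2 * (n + 1))), (if σ 0 = 0 then pfTerm H x σ else 0) := by
    intro u
    obtain ⟨ρ, hρ, hterm⟩ := exists_perm_pfTerm_mul H hH x u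
    refine Fintype.sum_equiv (Equiv.mulRight ρ) _ _ fun σ => ?_
    simp only [Equiv.coe_mulRight, Equiv.Perm.mul_apply, hρ, hterm]
  have hsplit : pfSum H x = ∑ u : Fin (2 * (n + 1)),
      ∑ σ : Equiv.Perm (Fin (2 * (n + 1))), (if σ u = 0 then pfTerm H x σ else 0) := by
    rw [Finset.sum_comm]
    refine Finset.sum_congr rfl fun σ _ => ?_
    have : ∀ u, (σ u = 0) = (u = σ.symm 0) := fun u => by
      rw [Equiv.eq_symm_apply]
    simp only [this, Finset.sum_ite_eq', Finset.mem_univ, if_true]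
    rfl
  rw [hsplit, Finset.sum_congr rfl fun u _ => hpos u, Finset.sum_const, Finset.card_univ,
    Fintype.card_fin, nsmul_eq_mul]
  congr 1
  change ∑ σ : Equiv.Perm (Fin (2 * n + 1 + 1)), (if σ 0 = 0 then pfTerm H x σ else 0) = _
  rw [← Equiv.sum_comp Equiv.Perm.decomposeFin.symm, Fintype.sum_prod_type,
    Finset.sum_eq_single (0 : Fin (2 * n + 1 + 1))]
  rotate_left
  · intro p _ hp
    simp [hp]
  · simp
  simp only [Equiv.Perm.decomposeFin_symm_apply_zero, if_true]
  rw [← Equiv.sum_comp Equiv.Perm.decomposeFin.symm, Fintype.sum_prod_type]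
  refine Finset.sum_congr rfl fun p _ => ?_
  unfold pfSum
  rw [Finset.mul_sum, Finset.mul_sum]
  refine Finset.sum_congr rfl fun e _ => ?_
  unfold pfTerm
  rw [Fin.prod_univ_succ]
  have h0 : (⟨2 * ((0 : Fin (n + 1)) : ℕ), by simp⟩ : Fin (2 * (n + 1))) =
    (0 : Fin (2 * n + 1 + 1)) := rfl
  have h1 : (⟨2 * ((0 : Fin (n + 1)) : ℕ) + 1, by simp; omega⟩ : Fin (2 * (n + 1))) =
    Fin.succ (0 : Fin (2 * n + 1)) := rfl
  have h2 : ∀ s : Fin n, (⟨2 * ((Fin.succ s : Fin (n + 1)) : ℕ), by omega⟩ :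
      Fin (2 * (n + 1))) =
    Fin.succ (Fin.succ (⟨2 * (s : ℕ), by omega⟩ : Fin (2 * n))) := fun s => by
      ext; simp; ring
  have h3 : ∀ s : Fin n, (⟨2 * ((Fin.succ s : Fin (n + 1)) : ℕ) + 1, by omega⟩ :
      Fin (2 * (n + 1))) =
    Fin.succ (Fin.succ (⟨2 * (s : ℕ) + 1, by omega⟩ : Fin (2 * n))) := fun s => by
      ext; simp; ring
  rw [h0, h1]
  simp only [h2, h3]
  simp only [Equiv.Perm.decomposeFin_symm_apply_zero, Equiv.Perm.decomposeFin_symm_apply_succ,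
    Equiv.Perm.decomposeFin.symm_sign, Equiv.swap_self, Equiv.refl_apply]
  by_cases hp : p = 0
  · simp only [hp, if_true, zsmul_eq_mul, one_mul]
    ring
  · simp only [hp, if_false, zsmul_eq_mul, neg_mul, one_mul]
    push_cast
    ring

theorem exists_swap_succ_eq {m : ℕ} {p w : Fin (m + 1)} (h : w ≠ p) :
    ∃ t : Fin m, Equiv.swap 0 p (Fin.succ t) = w := by
  have hne : Equiv.swap 0 p w ≠ 0 := by
    rw [Ne, Equiv.swap_apply_eq_iff, Equiv.swap_apply_left]
    exact h
  exact ⟨(Equiv.swap 0 p w).pred hne, by rw [Fin.succ_pred, Equiv.swap_apply_self]⟩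

end PfSum

/-- The tuple `(2z₀, 2z₀+1, 2z₁, 2z₁+1, …)` of indices. -/
def blockTuple {q k n : ℕ} (hkq : 2 * k ≤ q) (z : Fin n → Fin k) (t : Fin (2 * n)) : Fin q :=
  ⟨2 * (z ⟨(t : ℕ) / 2, by omega⟩ : ℕ) + (t : ℕ) % 2, by
    have := (z ⟨(t : ℕ) / 2, by omega⟩).isLt
    omega⟩

theorem pfSum_blockTuple_comp_perm {R : Type*} [CommRing R] {q k n : ℕ} (hkq : 2 * k ≤ q)
    (H : Fin q → Fin q → R) (z : Fin n → Fin k) (τ : Equiv.Perm (Fin n)) :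
    pfSum H (blockTuple hkq (z ∘ τ)) = pfSum H (blockTuple hkq z) := by
  obtain ⟨ρ, hsign, hρ⟩ := exists_perm_of_pairs τ
  have hcomp : blockTuple hkq (z ∘ τ) = blockTuple hkq z ∘ ρ := by
    funext t
    have ht : t = ⟨2 * ((⟨(t : ℕ) / 2, by omega⟩ : Fin n) : ℕ) + (t : ℕ) % 2, by
        simp only; omega⟩ := by
      ext; simp only; omega
    have hval := congrArg Fin.val
      ((congrArg ρ ht).trans (hρ ⟨(t : ℕ) / 2, by omega⟩ ((t : ℕ) % 2) (by omega)))
    simp only at hval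
    ext
    simp only [blockTuple, Function.comp_apply, hval]
    have h1 : (2 * (τ ⟨(t : ℕ) / 2, by omega⟩ : ℕ) + (t : ℕ) % 2) / 2 =
      (τ ⟨(t : ℕ) / 2, by omega⟩ : ℕ) := by omega
    simp only [h1, Fin.eta]
    omega
  rw [hcomp, pfSum_comp_perm, hsign]
  simp

theorem blockTuple_strictMono {q k n : ℕ} (hkq : 2 * k ≤ q) {z : Fin n → Fin k}
    (hz : StrictMono z) : StrictMono (blockTuple hkq z) := by
  intro t u htu
  have htu' : (t : ℕ) < u := htu
  simp only [blockTuple, Fin.lt_def]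
  rcases (show (t : ℕ) / 2 = (u : ℕ) / 2 ∨ (t : ℕ) / 2 < (u : ℕ) / 2 by omega) with h | h
  · simp only [h]
    omega
  · have : z ⟨(t : ℕ) / 2, by omega⟩ < z ⟨(u : ℕ) / 2, by omega⟩ := hz h
    rw [Fin.lt_def] at this
    omega

section Special

variable {q r k : ℕ} {H : Fin q → Fin q → ℂ} {a : ℂ}

/-- If the indices of `x` do not form a special set, the Pfaffian of `x` vanishes. -/
theorem pfSum_eq_zero (hkq : 2 * k ≤ q)
    (hnonspec : ∀ (I : Finset (Fin q)) (h : I.card = 2 * r),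
      ¬SpecialSet q k r I → pfaffian (psub (Matrix.of H) I h) = 0)
    (x : Fin (2 * r) → Fin q) (u : Fin (2 * r))
    (hu : 2 * k ≤ (x u : ℕ) ∨ ∀ v, v ≠ u → (x v : ℕ) / 2 ≠ (x u : ℕ) / 2) :
    pfSum H x = 0 := by
  by_cases hx : Function.Injective x
  swap
  · exact pfSum_eq_zero_of_not_injective H hx
  have hcard : (Finset.univ.image x).card = 2 * r := by
    rw [Finset.card_image_of_injective _ hx, Finset.card_univ, Fintype.card_fin]
  have hns : ¬SpecialSet q k r (Finset.univ.image x) := by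
    rintro ⟨K, hK, -, hmem⟩
    have hxu := (hmem (x u)).1 (by simp)
    have hlt := Finset.mem_range.1 (hK hxu)
    rcases hu with hu | hu
    · omega
    · obtain ⟨w, hw2, hwne⟩ : ∃ w : ℕ, w / 2 = (x u : ℕ) / 2 ∧ w ≠ x u :=
        ⟨2 * ((x u : ℕ) / 2) + (1 - (x u : ℕ) % 2), by omega, by omega⟩
      have hw := (hmem ⟨w, by omega⟩).2 (by simpa only [hw2] using hxu)
      obtain ⟨v, -, hv⟩ := Finset.mem_image.1 hw
      refine hu v ?_ (by rw [hv]; exact hw2)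
      rintro rfl
      exact hwne (by rw [hv])
  have hpf := hnonspec _ hcard hns
  rw [pfaffian_psub] at hpf
  have hsorted : pfSum H ((Finset.univ.image x).orderEmbOfFin hcard) = 0 :=
    (mul_eq_zero.1 hpf).resolve_left (by simp [r.factorial_ne_zero])
  obtain ⟨τ, hτ⟩ := exists_perm_eq_comp hx
    ((Finset.univ.image x).orderEmbOfFin hcard).injective (by simp)
  rw [hτ, pfSum_comp_perm, hsorted, smul_zero]

theorem pfSum_blockTuple (hkq : 2 * k ≤ q)
    (hspec : ∀ (I : Finset (Fin q)) (h : I.card = 2 * r),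
      SpecialSet q k r I → pfaffian (psub (Matrix.of H) I h) = a)
    {z : Fin r → Fin k} (hz : Function.Injective z) :
    pfSum H (blockTuple hkq z) = 2 ^ r * (r.factorial : ℂ) * a := by
  have hcardK : (Finset.univ.image z).card = r := by
    rw [Finset.card_image_of_injective _ hz, Finset.card_univ, Fintype.card_fin]
  set f := (Finset.univ.image z).orderEmbOfFin hcardK with hf
  have hrange : Set.range z = Set.range f := by simp [hf]
  obtain ⟨τ, hτ⟩ := exists_perm_eq_comp hz f.injective hrange
  rw [hτ, pfSum_blockTuple_comp_perm]
  have hmono := blockTuple_strictMono hkq f.strictMono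
  set x := blockTuple hkq f with hx
  have hcard : (Finset.univ.image x).card = 2 * r := by
    rw [Finset.card_image_of_injective _ hmono.injective, Finset.card_univ, Fintype.card_fin]
  have hs : SpecialSet q k r (Finset.univ.image x) := by
    refine ⟨(Finset.univ.image f).map Fin.valEmbedding, ?_, ?_, ?_⟩
    · intro m hm
      simp only [Finset.mem_map, Fin.valEmbedding_apply] at hm
      obtain ⟨b, -, rfl⟩ := hm
      simp
    · rw [Finset.card_map, Finset.card_image_of_injective _ f.injective, Finset.card_univ,
        Fintype.card_fin]
    · intro y
      simp only [Finset.mem_image, Finset.mem_univ, true_and, Finset.mem_map,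
        Fin.valEmbedding_apply, exists_exists_eq_and]
      constructor
      · rintro ⟨t, rfl⟩
        refine ⟨⟨(t : ℕ) / 2, by omega⟩, ?_⟩
        simp only [hx, blockTuple]
        omega
      · rintro ⟨s, hs⟩
        refine ⟨⟨2 * (s : ℕ) + (y : ℕ) % 2, by omega⟩, ?_⟩
        have h1 : (2 * (s : ℕ) + (y : ℕ) % 2) / 2 = s := by omega
        ext
        simp only [hx, blockTuple, h1, Fin.eta]
        omega
  have hpf := hspec _ hcard hs
  rw [pfaffian_psub, ← Finset.orderEmbOfFin_unique hcard (fun t => by simp) hmono] at hpf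
  have hfac : (r.factorial : ℂ) ≠ 0 := by exact_mod_cast r.factorial_ne_zero
  rw [← hpf]
  field_simp

theorem blockTuple_zero {n : ℕ} (hkq : 2 * k ≤ q) (z : Fin (n + 1) → Fin k) :
    ((blockTuple hkq z (0 : Fin (2 * (n + 1))) : Fin q) : ℕ) = 2 * z 0 := by
  simp [blockTuple]

theorem blockTuple_one {n : ℕ} (hkq : 2 * k ≤ q) (z : Fin (n + 1) → Fin k) :
    ((blockTuple hkq z (Fin.succ (0 : Fin (2 * n + 1))) : Fin q) : ℕ) = 2 * z 0 + 1 := by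
  have h : (Fin.succ (0 : Fin (2 * n + 1)) : Fin (2 * (n + 1))) = ⟨1, by omega⟩ := rfl
  rw [h]
  simp [blockTuple]

theorem blockTuple_succ_succ {n : ℕ} (hkq : 2 * k ≤ q) (z : Fin (n + 1) → Fin k)
    (t : Fin (2 * n)) :
    blockTuple hkq z (Fin.succ (Fin.succ t) : Fin (2 * n + 1 + 1)) =
      blockTuple hkq (z ∘ Fin.succ) t := by
  have h : ((t : ℕ) + 1 + 1) / 2 = (t : ℕ) / 2 + 1 := by omega
  ext
  simp only [blockTuple, Fin.val_succ, h, Function.comp_apply, Fin.succ_mk]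
  omega

theorem blockTuple_div_two {n : ℕ} (hkq : 2 * k ≤ q) (z : Fin n → Fin k) (t : Fin (2 * n)) :
    (blockTuple hkq z t : ℕ) / 2 = z ⟨(t : ℕ) / 2, by omega⟩ := by
  simp only [blockTuple]
  omega

/-- A tuple whose second entry has no partner among the remaining ones, except possibly the
first one: only one term of the row expansion survives. -/
theorem pfSum_succ_of_unpaired (hkq : 2 * k ≤ q) (hH : ∀ i j, H i j = -H j i)
    (hnonspec : ∀ (I : Finset (Fin q)) (h : I.card = 2 * r),
      ¬SpecialSet q k r I → pfaffian (psub (Matrix.of H) I h) = 0)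
    (x : Fin (2 * (r + 1)) → Fin q)
    (hx : ∀ t : Fin (2 * r), (x (Fin.succ (Fin.succ t) : Fin (2 * r + 1 + 1)) : ℕ) / 2 ≠
      (x (Fin.succ (0 : Fin (2 * r + 1))) : ℕ) / 2) :
    pfSum H x = (2 * (r + 1) : ℕ) * (H (x 0) (x (Fin.succ (0 : Fin (2 * r + 1)))) *
      pfSum H fun t : Fin (2 * r) => x (Fin.succ (Fin.succ t) : Fin (2 * r + 1 + 1))) := by
  rw [pfSum_succ H hH, Finset.sum_eq_single 0]
  · simp
  · intro p _ hp
    obtain ⟨u, hu⟩ := exists_swap_succ_eq (Ne.symm hp)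
    rw [pfSum_eq_zero hkq hnonspec _ u, mul_zero, mul_zero]
    refine Or.inr fun v hv => ?_
    rw [hu]
    have hne : Equiv.swap 0 p (Fin.succ v) ≠ 0 :=
      fun h => hv (Fin.succ_injective _ ((Equiv.swap 0 p).injective (h.trans hu.symm)))
    obtain ⟨w, hw⟩ := Fin.exists_succ_eq.2 hne
    rw [← hw]
    exact hx w
  · simp

theorem pfSum_succ_eq_zero (hkq : 2 * k ≤ q) (hH : ∀ i j, H i j = -H j i)
    (hnonspec : ∀ (I : Finset (Fin q)) (h : I.card = 2 * r),
      ¬SpecialSet q k r I → pfaffian (psub (Matrix.of H) I h) = 0)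
    (x : Fin (2 * (r + 1)) → Fin q) {u v : Fin (2 * r + 1)} (huv : u ≠ v)
    (hu : 2 * k ≤ (x u.succ : ℕ)) (hv : 2 * k ≤ (x v.succ : ℕ)) :
    pfSum H x = 0 := by
  rw [pfSum_succ H hH, Finset.sum_eq_zero, mul_zero]
  intro p _
  obtain ⟨w, hwp, hw⟩ : ∃ w : Fin (2 * r + 1), w ≠ p ∧ 2 * k ≤ (x w.succ : ℕ) := by
    by_cases h : u = p
    · exact ⟨v, fun hvp => huv (h.trans hvp.symm), hv⟩
    · exact ⟨u, h, hu⟩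
  obtain ⟨t, ht⟩ := exists_swap_succ_eq hwp
  rw [pfSum_eq_zero hkq hnonspec _ t (Or.inl (by rw [ht]; exact hw)), mul_zero, mul_zero]

/-- A pair of indices that is not one of the first `k` blocks has zero entry in `H`,
when the first index lies in one of these blocks. -/
theorem entry_eq_zero_of_lt (hkq : 2 * k ≤ q) (hH : ∀ i j, H i j = -H j i)
    (hr : 1 ≤ r) (hrk : r < k) (ha : a ≠ 0)
    (hspec : ∀ (I : Finset (Fin q)) (h : I.card = 2 * r),
      SpecialSet q k r I → pfaffian (psub (Matrix.of H) I h) = a)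
    (hnonspec : ∀ (I : Finset (Fin q)) (h : I.card = 2 * r),
      ¬SpecialSet q k r I → pfaffian (psub (Matrix.of H) I h) = 0)
    {i j : Fin q} (hi : (i : ℕ) < 2 * k) (hij : (i : ℕ) / 2 ≠ (j : ℕ) / 2) : H i j = 0 := by
  obtain ⟨z, hz, ⟨s, hs⟩, hzj⟩ : ∃ z : Fin r → Fin k, Function.Injective z ∧
      (∃ s, (z s : ℕ) = (i : ℕ) / 2) ∧ ∀ s, (z s : ℕ) ≠ (j : ℕ) / 2 := by
    let i' : Fin k := ⟨(i : ℕ) / 2, by omega⟩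
    let A : Finset (Fin k) := Finset.univ.filter fun m => (m : ℕ) ≠ (j : ℕ) / 2
    have hiA : {i'} ⊆ A := by
      simpa [A] using hij
    have hA : r ≤ A.card := by
      have h1 : (Finset.univ.filter fun m : Fin k => (m : ℕ) = (j : ℕ) / 2).card ≤ 1 := by
        rw [Finset.card_le_one]
        intro b hb c hc
        simp only [Finset.mem_filter, Finset.mem_univ, true_and] at hb hc
        exact Fin.ext (hb.trans hc.symm)
      have h2 := Finset.card_filter_add_card_filter_not (s := (Finset.univ : Finset (Fin k)))
        (fun m : Fin k => (m : ℕ) = (j : ℕ) / 2)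
      rw [Finset.card_univ, Fintype.card_fin] at h2
      change r ≤ (Finset.univ.filter fun m : Fin k => ¬ (m : ℕ) = (j : ℕ) / 2).card
      omega
    obtain ⟨K, hiK, hKA, hK⟩ := Finset.exists_subsuperset_card_eq hiA (by simpa using hr) hA
    refine ⟨K.orderEmbOfFin hK, (K.orderEmbOfFin hK).injective, ?_, fun s => ?_⟩
    · have : i' ∈ Set.range (K.orderEmbOfFin hK) := by
        rw [Finset.range_orderEmbOfFin]
        exact hiK (by simp)
      obtain ⟨s, hs⟩ := this
      exact ⟨s, by rw [hs]⟩
    · exact (Finset.mem_filter.1 (hKA (K.orderEmbOfFin_mem hK s))).2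
  let x : Fin (2 * (r + 1)) → Fin q :=
    Fin.cons (n := 2 * r + 1) i (Fin.cons (n := 2 * r) j (blockTuple hkq z))
  have hexp := pfSum_succ_of_unpaired hkq hH hnonspec x fun t => by
    change (blockTuple hkq z t : ℕ) / 2 ≠ (j : ℕ) / 2
    rw [blockTuple_div_two]
    exact hzj _
  have hzero : pfSum H x = 0 := by
    apply pfSum_eq_zero_of_not_injective
    intro hinj
    let t : Fin (2 * r) := ⟨2 * (s : ℕ) + (i : ℕ) % 2, by omega⟩
    have ht : blockTuple hkq z t = i := by
      have h1 : (2 * (s : ℕ) + (i : ℕ) % 2) / 2 = s := by omega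
      ext
      simp only [blockTuple, t, h1, Fin.eta, hs]
      omega
    have h0 : x (Fin.succ (Fin.succ t) : Fin (2 * r + 1 + 1)) = x 0 := ht
    exact Fin.succ_ne_zero _ (hinj h0)
  change _ = _ * (H i j * pfSum H (blockTuple hkq z)) at hexp
  rw [hzero, pfSum_blockTuple hkq hspec hz] at hexp
  have hfac : (r.factorial : ℂ) ≠ 0 := by exact_mod_cast r.factorial_ne_zero
  have hr1 : ((2 * (r + 1) : ℕ) : ℂ) ≠ 0 := by norm_cast
  have hval : 2 ^ r * (r.factorial : ℂ) * a ≠ 0 := by simp [hfac, ha]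
  exact ((mul_eq_zero.1 ((mul_eq_zero.1 hexp.symm).resolve_left hr1)).resolve_right hval)

/-- Entries of `H` outside the first `2k` rows and columns vanish. -/
theorem entry_eq_zero_of_ge (hkq : 2 * k ≤ q) (hH : ∀ i j, H i j = -H j i)
    (hr : 1 ≤ r) (hrk : r < k) (ha : a ≠ 0)
    (hspec : ∀ (I : Finset (Fin q)) (h : I.card = 2 * r),
      SpecialSet q k r I → pfaffian (psub (Matrix.of H) I h) = a)
    (hnonspec : ∀ (I : Finset (Fin q)) (h : I.card = 2 * r),
      ¬SpecialSet q k r I → pfaffian (psub (Matrix.of H) I h) = 0)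
    {i j : Fin q} (hi : 2 * k ≤ (i : ℕ)) (hj : 2 * k ≤ (j : ℕ)) : H i j = 0 := by
  let z : Fin r → Fin k := Fin.castLE hrk.le
  have hz : Function.Injective z := Fin.castLE_injective _
  let x : Fin (2 * (r + 1)) → Fin q :=
    Fin.cons (n := 2 * r + 1) i (Fin.cons (n := 2 * r) j (blockTuple hkq z))
  have hexp := pfSum_succ_of_unpaired hkq hH hnonspec x fun t => by
    change (blockTuple hkq z t : ℕ) / 2 ≠ (j : ℕ) / 2
    rw [blockTuple_div_two]
    have := (z ⟨(t : ℕ) / 2, by omega⟩).isLt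
    omega
  have hzero : pfSum H x = 0 := by
    let w : Fin (2 * (r + 1)) := ⟨2, by omega⟩
    have h0w : (0 : Fin (2 * (r + 1))) ≠ w := by simp [w, Fin.ext_iff]
    have hperm := pfSum_comp_perm H x (Equiv.swap 0 w)
    rw [pfSum_succ_eq_zero hkq hH hnonspec (x ∘ Equiv.swap 0 w)
      (u := ⟨0, by omega⟩) (v := ⟨1, by omega⟩) (by simp), Equiv.Perm.sign_swap h0w] at hperm
    · simpa using hperm.symm
    · rw [Function.comp_apply, Equiv.swap_apply_of_ne_of_ne (by simp)
        (by simp [w, Fin.ext_iff])]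
      exact hj
    · have : (Fin.succ ⟨1, by omega⟩ : Fin (2 * r + 1 + 1)) = w := rfl
      rw [Function.comp_apply, this, Equiv.swap_apply_right]
      exact hi
  change _ = _ * (H i j * pfSum H (blockTuple hkq z)) at hexp
  rw [hzero, pfSum_blockTuple hkq hspec hz] at hexp
  have hfac : (r.factorial : ℂ) ≠ 0 := by exact_mod_cast r.factorial_ne_zero
  have hr1 : ((2 * (r + 1) : ℕ) : ℂ) ≠ 0 := by norm_cast
  have hval : 2 ^ r * (r.factorial : ℂ) * a ≠ 0 := by simp [hfac, ha]
  exact ((mul_eq_zero.1 ((mul_eq_zero.1 hexp.symm).resolve_left hr1)).resolve_right hval)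

/-- All the `2 × 2` diagonal blocks of `H` among the first `k` are equal. -/
theorem block_entry_eq (hkq : 2 * k ≤ q) (hH : ∀ i j, H i j = -H j i)
    (hr : 1 ≤ r) (hrk : r < k) (ha : a ≠ 0)
    (hspec : ∀ (I : Finset (Fin q)) (h : I.card = 2 * r),
      SpecialSet q k r I → pfaffian (psub (Matrix.of H) I h) = a)
    (hnonspec : ∀ (I : Finset (Fin q)) (h : I.card = 2 * r),
      ¬SpecialSet q k r I → pfaffian (psub (Matrix.of H) I h) = 0)
    (m m' : Fin k) :
    H ⟨2 * (m : ℕ), by omega⟩ ⟨2 * (m : ℕ) + 1, by omega⟩ =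
      H ⟨2 * (m' : ℕ), by omega⟩ ⟨2 * (m' : ℕ) + 1, by omega⟩ := by
  rcases eq_or_ne m m' with rfl | hmm
  · rfl
  have hexp : ∀ z : Fin (r + 1) → Fin k, Function.Injective z →
      pfSum H (blockTuple hkq z) = (2 * (r + 1) : ℕ) *
        (H ⟨2 * (z 0 : ℕ), by omega⟩ ⟨2 * (z 0 : ℕ) + 1, by omega⟩ *
          (2 ^ r * (r.factorial : ℂ) * a)) := by
    intro z hz
    rw [pfSum_succ_of_unpaired hkq hH hnonspec]
    · simp only [blockTuple_succ_succ]
      rw [pfSum_blockTuple hkq hspec (hz.comp (Fin.succ_injective _))]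
      congr 3
      · exact Fin.ext (blockTuple_zero hkq z)
      · exact Fin.ext (blockTuple_one hkq z)
    · intro t
      rw [blockTuple_succ_succ, blockTuple_div_two, blockTuple_one]
      have h1 : (2 * (z 0 : ℕ) + 1) / 2 = z 0 := by omega
      rw [h1, Ne, ← Fin.ext_iff]
      exact fun h => Fin.succ_ne_zero _ (hz h)
  obtain ⟨K, hmK, -, hK⟩ := Finset.exists_subsuperset_card_eq
    (Finset.subset_univ ({m, m'} : Finset (Fin k))) (n := r + 1)
    (by rw [Finset.card_pair hmm]; omega) (by simpa using hrk)
  have hmem : ∀ b ∈ ({m, m'} : Finset (Fin k)), ∃ s, K.orderEmbOfFin hK s = b := by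
    intro b hb
    have : b ∈ Set.range (K.orderEmbOfFin hK) := by
      rw [Finset.range_orderEmbOfFin]
      exact hmK hb
    exact this
  have hval : ∀ s, pfSum H (blockTuple hkq (K.orderEmbOfFin hK)) = (2 * (r + 1) : ℕ) *
      (H ⟨2 * (K.orderEmbOfFin hK s : ℕ), by omega⟩
        ⟨2 * (K.orderEmbOfFin hK s : ℕ) + 1, by omega⟩ * (2 ^ r * (r.factorial : ℂ) * a)) := by
    intro s
    rw [← pfSum_blockTuple_comp_perm hkq H (K.orderEmbOfFin hK) (Equiv.swap 0 s),
      hexp _ ((K.orderEmbOfFin hK).injective.comp (Equiv.injective _))]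
    simp only [Function.comp_apply, Equiv.swap_apply_left]
  obtain ⟨s, hs⟩ := hmem m (by simp)
  obtain ⟨s', hs'⟩ := hmem m' (by simp)
  have heq := (hval s).symm.trans (hval s')
  simp only [hs, hs'] at heq
  have hfac : (r.factorial : ℂ) ≠ 0 := by exact_mod_cast r.factorial_ne_zero
  have hr1 : ((2 * (r + 1) : ℕ) : ℂ) ≠ 0 := by norm_cast
  exact mul_right_cancel₀ (by simp [hfac, ha]) (mul_left_cancel₀ hr1 heq)

end Special

/-- If `r < k` and all Pfaffians of principal `2r × 2r` submatrices of a skew-symmetric `H`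
on special subsets equal a fixed `a ≠ 0` while all others vanish, then `H` is a nonzero
scalar multiple of the block diagonal matrix with `k` copies of `J` followed by a zero
block. -/
theorem pfaffian_rigidity_lemma (q r k : ℕ) (hq : 2 ≤ q)
    (H : Matrix (Fin q) (Fin q) ℂ) (hH : Hᵀ = -H)
    (hr : 1 ≤ r) (hrk : r < k) (hkq : 2 * k ≤ q)
    (a : ℂ) (ha : a ≠ 0)
    (hspec : ∀ (I : Finset (Fin q)) (h : I.card = 2 * r),
      SpecialSet q k r I → pfaffian (psub H I h) = a)
    (hnonspec : ∀ (I : Finset (Fin q)) (h : I.card = 2 * r),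
      ¬SpecialSet q k r I → pfaffian (psub H I h) = 0) :
    ∃ c : ℂ, c ≠ 0 ∧ H = c • Sblock q k := by
  have hskew : ∀ i j, H i j = -H j i := fun i j => by
    simpa using congrFun (congrFun hH j) i
  have hdiag : ∀ i, H i i = 0 := fun i => self_eq_neg.1 (hskew i i)
  have hblock := block_entry_eq hkq hskew hr hrk ha hspec hnonspec ⟨0, by omega⟩
  have heq : H = H ⟨0, by omega⟩ ⟨1, by omega⟩ • Sblock q k := by
    ext i j
    simp only [Matrix.smul_apply, Sblock, Matrix.of_apply, smul_eq_mul]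
    by_cases hij : (i : ℕ) / 2 = (j : ℕ) / 2
    · by_cases hik : (i : ℕ) / 2 < k
      · have hb := hblock ⟨(i : ℕ) / 2, hik⟩
        simp only [mul_zero, zero_add] at hb
        rw [if_pos ⟨hij, hik⟩]
        split_ifs with h1 h2
        · rw [hb, mul_one]
          congr 1 <;> ext <;> simp only <;> omega
        · rw [hb, mul_neg_one, hskew i j]
          congr 2 <;> ext <;> simp only <;> omega
        · have : i = j := by ext; omega
          rw [this, hdiag, mul_zero]
      · rw [if_neg (fun h => hik h.2), mul_zero]
        exact entry_eq_zero_of_ge hkq hskew hr hrk ha hspec hnonspec (by omega) (by omega)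
    · rw [if_neg (fun h => hij h.1), mul_zero]
      by_cases hi : (i : ℕ) < 2 * k
      · exact entry_eq_zero_of_lt hkq hskew hr hrk ha hspec hnonspec hi hij
      · by_cases hj : (j : ℕ) < 2 * k
        · rw [hskew, entry_eq_zero_of_lt hkq hskew hr hrk ha hspec hnonspec hj (Ne.symm hij),
            neg_zero]
        · exact entry_eq_zero_of_ge hkq hskew hr hrk ha hspec hnonspec (by omega) (by omega)
  refine ⟨_, fun hc => ?_, heq⟩
  have hH0 : H = 0 := by rw [heq, hc, zero_smul]
  have hpf := pfSum_blockTuple hkq hspec (Fin.castLE_injective hrk.le)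
  have hpf0 : pfSum H (blockTuple hkq (Fin.castLE hrk.le)) = 0 := by
    have : r ≠ 0 := by omega
    simp [pfSum, hH0, this]
  rw [hpf0] at hpf
  simp [ha, r.factorial_ne_zero] at hpf

end
end
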